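/- arXiv:1110.0425 — 3 statements merged into one kernel-verified Lean document; each statement's English description precedes it below -/
import Mathlib

section
/- For a memoryless point-to-point communication system with strictly causal encoder (achievability direction of Theorem 3): if there exists a finite set 𝒱 and a joint pmf P_{SXYŜV} that factors as P_S(s)·P_X(x)·P_{V|XS}(v|x,s)·P_{Y|X}(y|x)·P_{Ŝ|VY}(ŝ|v,y) and satisfies I(X,V;S) ≤ I(X,V;Y), then the marginal P_{SXYŜ} is achievable with a strictly causal encoder. -/
open scoped BigOperators

noncomputable section

/-- `p` is a probability mass function on the finite type `α`. -/
def IsPMF {α : Type*} [Fintype α] (p : α → ℝ) : Prop :=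
  (∀ a, 0 ≤ p a) ∧ (∑ a, p a) = 1

/-- Probability of the event `E` under the pmf `P`. -/
def prob {Ω : Type*} [Fintype Ω] (P : Ω → ℝ) (E : Set Ω) : ℝ :=
  ∑ ω, E.indicator P ω

/-- Probability that the random variable `f` takes the value `a`, under `P`. -/
def margProb {Ω A : Type*} [Fintype Ω] (P : Ω → ℝ) (f : Ω → A) (a : A) : ℝ :=
  prob P {ω | f ω = a}

/-- Mutual information `I(f;g)` (base-2 logarithms) of random variables `f`, `g`
defined on a finite probability space with pmf `P`. -/
def mutInfo {Ω A B : Type*} [Fintype Ω] [Fintype A] [Fintype B]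
    (P : Ω → ℝ) (f : Ω → A) (g : Ω → B) : ℝ :=
  ∑ a : A, ∑ b : B,
    margProb P (fun ω => (f ω, g ω)) (a, b) *
      Real.logb 2 (margProb P (fun ω => (f ω, g ω)) (a, b) /
        (margProb P f a * margProb P g b))

/-- Conditional mutual information `I(f;g|h)` (base-2 logarithms). -/
def condMutInfo {Ω A B C : Type*} [Fintype Ω] [Fintype A] [Fintype B] [Fintype C]
    (P : Ω → ℝ) (f : Ω → A) (g : Ω → B) (h : Ω → C) : ℝ :=
  ∑ a : A, ∑ b : B, ∑ c : C,
    margProb P (fun ω => (f ω, g ω, h ω)) (a, b, c) *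
      Real.logb 2
        ((margProb P (fun ω => (f ω, g ω, h ω)) (a, b, c) * margProb P h c) /
          (margProb P (fun ω => (f ω, h ω)) (a, c) *
            margProb P (fun ω => (g ω, h ω)) (b, c)))

/-- Total variation distance between two pmfs: half the ℓ¹ distance. -/
def tvDist {α : Type*} [Fintype α] (P Q : α → ℝ) : ℝ :=
  (∑ a, |P a - Q a|) / 2

/-- Empirical distribution of the sequence `w`. -/
def empDist {n : ℕ} {α : Type*} (w : Fin n → α) (a : α) : ℝ :=
  (∑ i : Fin n, ({i | w i = a} : Set (Fin n)).indicator (fun _ => (1 : ℝ)) i) / n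

/-- Causality classes for the encoder. -/
inductive EncoderClass | noncausal | causal | strictlyCausal

/-- The encoder `f` respects the causality class `c`:
a noncausal encoder has `Xᵢ = fᵢ(Sⁿ)`, a causal encoder has `Xᵢ = fᵢ(Sⁱ)`
(it only depends on `S₁,…,Sᵢ`), and a strictly causal encoder has
`Xᵢ = fᵢ(Sⁱ⁻¹)` (it only depends on `S₁,…,Sᵢ₋₁`). -/
def EncOK {n : ℕ} {S X : Type*} : EncoderClass → (Fin n → (Fin n → S) → X) → Prop
  | .noncausal, _ => True
  | .causal, f => ∀ (i : Fin n) (s s' : Fin n → S),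
      (∀ j, j ≤ i → s j = s' j) → f i s = f i s'
  | .strictlyCausal, f => ∀ (i : Fin n) (s s' : Fin n → S),
      (∀ j, j < i → s j = s' j) → f i s = f i s'

/-- The joint pmf of `(Sⁿ, Yⁿ)` induced by the i.i.d. source `PS`, the memoryless
channel `PYX` and the (deterministic) encoder `f`. -/
def inducedP {S X Y : Type*} {n : ℕ}
    (PS : S → ℝ) (PYX : X → Y → ℝ) (f : Fin n → (Fin n → S) → X) :
    (Fin n → S) × (Fin n → Y) → ℝ :=
  fun sy => (∏ i, PS (sy.1 i)) * ∏ i, PYX (f i sy.1) (sy.2 i)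

/-- `P` (a pmf on `S × X × Y × Z`) is achievable for the source `PS` and channel `PYX`
with an encoder of causality class `c`: for every `ε > 0` there are a block length
`n` and a block-`n` code such that with probability at least `1 - ε` the empirical
distribution of `(Sⁿ, Xⁿ, Yⁿ, Ŝⁿ)` is within total variation `ε` of `P`. -/
def Achievable {S X Y Z : Type*} [Fintype S] [Fintype X] [Fintype Y] [Fintype Z]
    (PS : S → ℝ) (PYX : X → Y → ℝ) (c : EncoderClass)
    (P : S × X × Y × Z → ℝ) : Prop :=
  ∀ ε : ℝ, 0 < ε →
    ∃ n : ℕ, 0 < n ∧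
      ∃ (f : Fin n → (Fin n → S) → X) (g : Fin n → (Fin n → Y) → Z),
        EncOK c f ∧
        prob (inducedP PS PYX f)
          {sy | ε <
            tvDist (empDist (fun i => (sy.1 i, f i sy.1, sy.2 i, g i sy.2))) P} < ε

theorem IsPMF.pi {ι A : Type*} [Fintype ι] [DecidableEq ι] [Fintype A] {p : ι → A → ℝ}
    (hp : ∀ i, IsPMF (p i)) : IsPMF (fun w : ι → A => ∏ i, p i (w i)) := by
  refine ⟨fun w => Finset.prod_nonneg fun i _ => (hp i).1 _, ?_⟩
  have h := Finset.prod_univ_sum (fun _ : ι => (Finset.univ : Finset A)) p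
  rw [Fintype.piFinset_univ] at h
  rw [← h]
  exact Finset.prod_eq_one fun i _ => (hp i).2

theorem IsPMF.sum_mul_le {A : Type*} [Fintype A] {p : A → ℝ} (hp : IsPMF p) {F : A → ℝ} {c : ℝ}
    (h : ∀ a, F a ≤ c) : ∑ a, p a * F a ≤ c := by
  calc ∑ a, p a * F a ≤ ∑ a, p a * c :=
        Finset.sum_le_sum fun a _ => mul_le_mul_of_nonneg_left (h a) (hp.1 a)
    _ = c := by rw [← Finset.sum_mul, hp.2, one_mul]

theorem IsPMF.exists_le_of_sum_mul_le {A : Type*} [Fintype A] {p : A → ℝ} (hp : IsPMF p)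
    {F : A → ℝ} {c : ℝ} (h : ∑ a, p a * F a ≤ c) : ∃ a, F a ≤ c := by
  by_contra! hlt
  have hne : ∃ a, 0 < p a := by
    by_contra! hz
    have := hp.2
    have h0 : ∑ a, p a ≤ 0 := Finset.sum_nonpos fun a _ => hz a
    linarith
  obtain ⟨a₀, ha₀⟩ := hne
  have h1 : ∑ a, p a * c < ∑ a, p a * F a :=
    Finset.sum_lt_sum (fun a _ => mul_le_mul_of_nonneg_left (hlt a).le (hp.1 a))
      ⟨a₀, Finset.mem_univ _, mul_lt_mul_of_pos_left (hlt a₀) ha₀⟩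
  rw [← Finset.sum_mul, hp.2, one_mul] at h1
  linarith

/-- If resampling the coordinate `b` makes the mean of `F` at most `c` whatever the other
coordinates are, then the mean of `F` under the product law is at most `c`. -/
theorem sum_prod_mul_le_of_update {ι A : Type*} [Fintype ι] [DecidableEq ι] [Fintype A]
    {p : ι → A → ℝ} (hp : ∀ i, IsPMF (p i)) (b : ι) (F : (ι → A) → ℝ) (c : ℝ)
    (h : ∀ s, ∑ a, p b a * F (Function.update s b a) ≤ c) :
    ∑ s : ι → A, (∏ i, p i (s i)) * F s ≤ c := by
  have hw : ∀ (s : ι → A) (a : A),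
      (∏ i, p i (Function.update s b a i)) * p b (s b) = (∏ i, p i (s i)) * p b a := by
    intro s a
    rw [← Finset.mul_prod_erase _ _ (Finset.mem_univ b),
      ← Finset.mul_prod_erase Finset.univ (fun i => p i (s i)) (Finset.mem_univ b),
      Finset.prod_congr rfl (g := fun i => p i (s i)) (fun i hi => by
        rw [Function.update_of_ne (Finset.ne_of_mem_erase hi)])]
    simp only [Function.update_self]
    ring
  let e : (ι → A) × A ≃ (ι → A) × A :=
    { toFun := fun q => (Function.update q.1 b q.2, q.1 b)
      invFun := fun q => (Function.update q.1 b q.2, q.1 b)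
      left_inv := fun q => by simp
      right_inv := fun q => by simp }
  calc ∑ s : ι → A, (∏ i, p i (s i)) * F s
      = ∑ q : (ι → A) × A, (∏ i, p i (q.1 i)) * p b q.2 * F q.1 := by
        rw [Fintype.sum_prod_type]
        refine Finset.sum_congr rfl fun s _ => ?_
        simp only
        rw [← Finset.sum_mul, ← Finset.mul_sum, (hp b).2, mul_one]
    _ = ∑ q : (ι → A) × A, (∏ i, p i (q.1 i)) * p b q.2 * F (Function.update q.1 b q.2) := by
        rw [← e.sum_comp]
        refine Finset.sum_congr rfl fun q _ => ?_
        simp only [e, Equiv.coe_fn_mk]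
        rw [hw]
    _ = ∑ s : ι → A, (∏ i, p i (s i)) * ∑ a, p b a * F (Function.update s b a) := by
        rw [Fintype.sum_prod_type]
        refine Finset.sum_congr rfl fun s _ => ?_
        rw [Finset.mul_sum]
        exact Finset.sum_congr rfl fun a _ => by ring
    _ ≤ c := (IsPMF.pi hp).sum_mul_le h

theorem sum_fin_prod_type {n : ℕ} {A B : Type*} [Fintype A] [Fintype B]
    (F : (Fin n → A × B) → ℝ) :
    ∑ w, F w = ∑ a : Fin n → A, ∑ b : Fin n → B, F (fun i => (a i, b i)) := by
  rw [← Fintype.sum_prod_type' (f := fun (a : Fin n → A) (b : Fin n → B) =>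
    F (fun i => (a i, b i)))]
  rw [← (Equiv.arrowProdEquivProdArrow (Fin n) (fun _ => A) (fun _ => B)).sum_comp]
  rfl

theorem sum_prod_cons {n : ℕ} {A : Type*} [Fintype A] (F : (Fin (n + 1) → A) → ℝ) :
    ∑ w, F w = ∑ a : A, ∑ w : Fin n → A, F (Fin.cons a w) := by
  rw [← Fintype.sum_prod_type' (f := fun (a : A) (w : Fin n → A) =>
    F (Fin.cons a w : Fin (n + 1) → A))]
  rw [← (Fin.consEquiv (fun _ => A)).sum_comp]
  rfl

theorem iid_sum_eq_zero {A : Type*} [Fintype A] {p : A → ℝ} (hp : IsPMF p) {h : A → ℝ}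
    (h0 : ∑ a, p a * h a = 0) (n : ℕ) :
    ∑ w : Fin n → A, (∏ i, p (w i)) * ∑ i, h (w i) = 0 := by
  induction n with
  | zero => simp
  | succ n ih =>
    have h1 : ∑ w : Fin n → A, ∏ i, p (w i) = 1 := (IsPMF.pi (fun _ : Fin n => hp)).2
    rw [sum_prod_cons]
    simp only [Fin.prod_univ_succ, Fin.sum_univ_succ, Fin.cons_zero, Fin.cons_succ]
    calc _ = ∑ a, ((p a * h a) * (∑ w : Fin n → A, ∏ i, p (w i))
          + p a * ∑ w : Fin n → A, (∏ i, p (w i)) * ∑ i, h (w i)) := by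
          refine Finset.sum_congr rfl fun a _ => ?_
          rw [Finset.mul_sum, Finset.mul_sum, ← Finset.sum_add_distrib]
          exact Finset.sum_congr rfl fun w _ => by ring
      _ = 0 := by
          rw [ih, h1]
          simpa using h0

theorem iid_sum_sq {A : Type*} [Fintype A] {p : A → ℝ} (hp : IsPMF p) {h : A → ℝ}
    (h0 : ∑ a, p a * h a = 0) (n : ℕ) :
    ∑ w : Fin n → A, (∏ i, p (w i)) * (∑ i, h (w i)) ^ 2 = n * ∑ a, p a * h a ^ 2 := by
  induction n with
  | zero => simp
  | succ n ih =>
    have h1 : ∑ w : Fin n → A, ∏ i, p (w i) = 1 := (IsPMF.pi (fun _ : Fin n => hp)).2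
    have h2 := iid_sum_eq_zero hp h0 n
    rw [sum_prod_cons]
    simp only [Fin.prod_univ_succ, Fin.sum_univ_succ, Fin.cons_zero, Fin.cons_succ]
    calc _ = ∑ a, ((p a * h a ^ 2) * (∑ w : Fin n → A, ∏ i, p (w i))
          + (2 * (p a * h a)) * (∑ w : Fin n → A, (∏ i, p (w i)) * ∑ i, h (w i))
          + p a * ∑ w : Fin n → A, (∏ i, p (w i)) * (∑ i, h (w i)) ^ 2) := by
          refine Finset.sum_congr rfl fun a _ => ?_
          rw [Finset.mul_sum, Finset.mul_sum, Finset.mul_sum, ← Finset.sum_add_distrib,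
            ← Finset.sum_add_distrib]
          exact Finset.sum_congr rfl fun w _ => by ring
      _ = _ := by
          rw [ih, h1, h2, Finset.sum_add_distrib, ← Finset.sum_mul, hp.2]
          push_cast
          simp
          ring

/-- Weak law of large numbers in mean. -/
theorem eventually_iid_mean_abs_le {A : Type*} [Fintype A] {p : A → ℝ} (hp : IsPMF p)
    (h : A → ℝ) {η : ℝ} (hη : 0 < η) :
    ∀ᶠ n : ℕ in Filter.atTop,
      ∑ w : Fin n → A, (∏ i, p (w i)) * |(∑ i, h (w i)) / n - ∑ a, p a * h a| ≤ η := by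
  set m := ∑ a, p a * h a with hm
  set v := ∑ a, p a * (h a - m) ^ 2 with hv
  have hv0 : 0 ≤ v := Finset.sum_nonneg fun a _ => mul_nonneg (hp.1 a) (sq_nonneg _)
  have h0 : ∑ a, p a * (h a - m) = 0 := by
    simp only [mul_sub, Finset.sum_sub_distrib, ← Finset.sum_mul, hp.2]
    rw [← hm]
    ring
  obtain ⟨N, hN⟩ := exists_nat_gt (v / (η / 2) ^ 2)
  filter_upwards [Filter.eventually_ge_atTop (N + 1)] with n hn
  have hn0 : (0 : ℝ) < n := by exact_mod_cast (by omega : 0 < n)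
  have hnv : v / (η / 2) ^ 2 ≤ n := by
    have : (N : ℝ) ≤ n := by exact_mod_cast (by omega : N ≤ n)
    linarith
  have habs : ∀ t : ℝ, |t| ≤ η / 2 + t ^ 2 / (η / 2) := by
    intro t
    rw [← sq_abs, ← sub_nonneg]
    have : η / 2 + |t| ^ 2 / (η / 2) - |t| =
      ((|t| - η / 4) ^ 2 + 3 * (η / 4) ^ 2) / (η / 2) := by
      field_simp
      ring
    rw [this]
    positivity
  have hsq := iid_sum_sq hp h0 n
  rw [← hv] at hsq
  calc _ ≤ ∑ w : Fin n → A, (∏ i, p (w i)) *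
        (η / 2 + ((∑ i, h (w i)) / n - m) ^ 2 / (η / 2)) :=
        Finset.sum_le_sum fun w _ => mul_le_mul_of_nonneg_left (habs _)
          (Finset.prod_nonneg fun i _ => hp.1 _)
    _ = η / 2 + (∑ w : Fin n → A, (∏ i, p (w i)) * (∑ i, (h (w i) - m)) ^ 2)
          / (n ^ 2 * (η / 2)) := by
        have h1 : ∑ w : Fin n → A, ∏ i, p (w i) = 1 := (IsPMF.pi (fun _ : Fin n => hp)).2
        simp only [mul_add]
        rw [Finset.sum_add_distrib, ← Finset.sum_mul, h1, one_mul, Finset.sum_div]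
        congr 1
        refine Finset.sum_congr rfl fun w _ => ?_
        simp only [Finset.sum_sub_distrib, Finset.sum_const, Finset.card_univ, Fintype.card_fin,
          nsmul_eq_mul]
        field_simp
    _ ≤ η := by
        rw [hsq]
        rw [div_le_iff₀ (by positivity)] at hnv
        have : n * v / (n ^ 2 * (η / 2)) ≤ η / 2 := by
          rw [div_le_iff₀ (by positivity)]
          nlinarith
        linarith

theorem empDist_eq {n : ℕ} {A : Type*} [DecidableEq A] (w : Fin n → A) (a : A) :
    empDist w a = (∑ i, if w i = a then (1 : ℝ) else 0) / n := by
  simp [empDist, Set.indicator_apply]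

theorem isPMF_empDist {n : ℕ} (hn : 0 < n) {A : Type*} [Fintype A] (w : Fin n → A) :
    IsPMF (empDist w) := by
  classical
  have hn0 : (n : ℝ) ≠ 0 := by exact_mod_cast hn.ne'
  refine ⟨fun a => ?_, ?_⟩
  · rw [empDist_eq]
    exact div_nonneg (Finset.sum_nonneg fun i _ => by split_ifs <;> norm_num) n.cast_nonneg
  · simp only [empDist_eq]
    rw [← Finset.sum_div, Finset.sum_comm]
    simp [hn0]

theorem tvDist_nonneg {A : Type*} [Fintype A] (P Q : A → ℝ) : 0 ≤ tvDist P Q :=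
  div_nonneg (Finset.sum_nonneg fun _ _ => abs_nonneg _) zero_le_two

theorem tvDist_le_one {A : Type*} [Fintype A] {P Q : A → ℝ} (hP : IsPMF P) (hQ : IsPMF Q) :
    tvDist P Q ≤ 1 := by
  have : ∑ a, |P a - Q a| ≤ ∑ a, (P a + Q a) := Finset.sum_le_sum fun a _ => by
    have := hP.1 a
    have := hQ.1 a
    rw [abs_le]
    constructor <;> linarith
  rw [Finset.sum_add_distrib, hP.2, hQ.2] at this
  unfold tvDist
  linarith

theorem tvDist_triangle {A : Type*} [Fintype A] (P Q R : A → ℝ) :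
    tvDist P R ≤ tvDist P Q + tvDist Q R := by
  unfold tvDist
  rw [← add_div, ← Finset.sum_add_distrib]
  gcongr
  exact abs_sub_le _ _ _

open Classical in
theorem eventually_iid_tvDist_le {A B : Type*} [Fintype A] [Fintype B] {p : A → ℝ}
    (hp : IsPMF p) (T : A → B) {P : B → ℝ} (hP : ∀ b, P b = ∑ a, p a * if T a = b then 1 else 0)
    {η : ℝ} (hη : 0 < η) :
    ∀ᶠ n : ℕ in Filter.atTop,
      ∑ w : Fin n → A, (∏ i, p (w i)) * tvDist (empDist (fun i => T (w i))) P ≤ η := by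
  have hc : (0 : ℝ) < Fintype.card B + 1 := by positivity
  have key := fun b : B => eventually_iid_mean_abs_le hp (fun a => if T a = b then (1 : ℝ) else 0)
    (div_pos hη hc)
  filter_upwards [Filter.eventually_all.2 key] with n hn
  calc _ = (∑ b, ∑ w : Fin n → A, (∏ i, p (w i)) *
        |(∑ i, if T (w i) = b then (1 : ℝ) else 0) / n
          - ∑ a, p a * if T a = b then (1 : ℝ) else 0|) / 2 := by
        rw [Finset.sum_comm, Finset.sum_div]
        refine Finset.sum_congr rfl fun w _ => ?_
        rw [← Finset.mul_sum, mul_div_assoc]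
        simp only [tvDist, empDist_eq, hP]
    _ ≤ (∑ b : B, η / (Fintype.card B + 1)) / 2 := by
        gcongr with b
        exact hn b
    _ ≤ η := by
        rw [Finset.sum_const, Finset.card_univ, nsmul_eq_mul]
        have : (Fintype.card B : ℝ) * (η / (Fintype.card B + 1)) ≤ η := by
          rw [mul_div_assoc', div_le_iff₀ hc]
          nlinarith
        linarith

open Classical in
/-- Asymptotic equipartition: the likelihood ratio of `num` against `den` exceeds `exp (n R)`
with vanishing probability once `R` is larger than the mean log-likelihood ratio. -/
theorem eventually_iid_likelihood_le {A : Type*} [Fintype A] {p : A → ℝ} (hp : IsPMF p)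
    (num den : A → ℝ) (hnum : ∀ a, 0 < p a → 0 < num a) (hden : ∀ a, 0 < p a → 0 < den a)
    {R : ℝ} (hR : ∑ a, p a * Real.log (num a / den a) < R) {η : ℝ} (hη : 0 < η) :
    ∀ᶠ n : ℕ in Filter.atTop,
      ∑ w : Fin n → A, (∏ i, p (w i)) *
        (if Real.exp (n * R) * ∏ i, den (w i) < ∏ i, num (w i) then 1 else 0) ≤ η := by
  set L := ∑ a, p a * Real.log (num a / den a) with hL
  have hRL : 0 < R - L := sub_pos.2 hR
  filter_upwards [eventually_iid_mean_abs_le hp (fun a => Real.log (num a / den a))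
    (mul_pos hη hRL), Filter.eventually_gt_atTop 0] with n hn hn0
  have hn0' : (0 : ℝ) < n := by exact_mod_cast hn0
  have : ∀ w : Fin n → A, (∏ i, p (w i)) *
      (if Real.exp (n * R) * ∏ i, den (w i) < ∏ i, num (w i) then 1 else 0) ≤
      ((∏ i, p (w i)) * |(∑ i, Real.log (num (w i) / den (w i))) / n - L|) / (R - L) := by
    intro w
    have hw0 : 0 ≤ ∏ i, p (w i) := Finset.prod_nonneg fun i _ => hp.1 _
    rcases hw0.eq_or_lt with h | h
    · rw [← h]
      simp
    · have hpos : ∀ i, 0 < p (w i) := fun i => lt_of_le_of_ne (hp.1 _) fun h0 =>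
        h.ne' (Finset.prod_eq_zero (Finset.mem_univ i) h0.symm)
      rw [mul_div_assoc]
      refine mul_le_mul_of_nonneg_left ?_ hw0
      split_ifs with hlt
      · rw [le_div_iff₀ hRL, one_mul]
        have hd : 0 < ∏ i, den (w i) := Finset.prod_pos fun i _ => hden _ (hpos i)
        rw [← lt_div_iff₀ hd, ← Finset.prod_div_distrib] at hlt
        have h2 := Real.log_lt_log (Real.exp_pos _) hlt
        rw [Real.log_exp, Real.log_prod (fun i _ =>
          (div_pos (hnum _ (hpos i)) (hden _ (hpos i))).ne')] at h2
        have h3 : R < (∑ i, Real.log (num (w i) / den (w i))) / n := by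
          rw [lt_div_iff₀ hn0']
          linarith
        exact le_trans (by linarith) (le_abs_self _)
      · positivity
  calc _ ≤ _ := Finset.sum_le_sum fun w _ => this w
    _ ≤ η := by
        rw [← Finset.sum_div, div_le_iff₀ hRL]
        exact hn

/-- The message sent in each block of a block-Markov scheme: the next message is a function of the
current message and of the source block. -/
def blockMessage {A M : Type*} (enc : M → A → M) (m₀ : M) {B : ℕ} (s : Fin B → A) : ℕ → M
  | 0 => m₀
  | b + 1 => if h : b < B then enc (blockMessage enc m₀ s b) (s ⟨b, h⟩) else
      blockMessage enc m₀ s b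

theorem blockMessage_congr {A M : Type*} (enc : M → A → M) (m₀ : M) {B : ℕ} {s s' : Fin B → A}
    (b : ℕ) (h : ∀ j : Fin B, (j : ℕ) < b → s j = s' j) :
    blockMessage enc m₀ s b = blockMessage enc m₀ s' b := by
  induction b with
  | zero => rfl
  | succ b ih =>
    have h1 := ih fun j hj => h j (by omega)
    simp only [blockMessage, h1]
    split_ifs with hb
    · rw [h ⟨b, hb⟩ (by simp)]
    · rfl

theorem blockMessage_update {A M : Type*} (enc : M → A → M) (m₀ : M) {B : ℕ} (s : Fin B → A)
    (b : Fin B) (a : A) :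
    blockMessage enc m₀ (Function.update s b a) b = blockMessage enc m₀ s b :=
  blockMessage_congr enc m₀ b fun j hj =>
    Function.update_of_ne (fun h => by subst h; exact lt_irrefl _ hj) _ _

theorem blockMessage_succ {A M : Type*} (enc : M → A → M) (m₀ : M) {B : ℕ} (s : Fin B → A)
    (b : Fin B) :
    blockMessage enc m₀ s (b + 1) = enc (blockMessage enc m₀ s b) (s b) := by
  simp [blockMessage]

/-- Mean cost of one block of a block-Markov scheme. -/
theorem blockMarkov_cost_le {A Y M : Type*} [Fintype A] [Fintype Y] {B : ℕ}
    {p : A → ℝ} (hp : IsPMF p) {W : M → Y → ℝ} (hW : ∀ m, IsPMF (W m))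
    (enc : M → A → M) (dec : Y → M) (m₀ : M) (D : A → M → Y → M → M → ℝ)
    [DecidableEq M]
    (hD0 : ∀ s m y m₁ m₂, 0 ≤ D s m y m₁ m₂) (hD1 : ∀ s m y m₁ m₂, D s m y m₁ m₂ ≤ 1) {η : ℝ}
    (hdec : ∀ m, ∑ y, W m y * (if dec y ≠ m then 1 else 0) ≤ η)
    (hcov : ∀ m, ∑ s, p s * ∑ y, W m y * D s m y m (enc m s) ≤ η)
    (b b' : Fin B) (hb : (b' : ℕ) = b + 1) :
    ∑ s : Fin B → A, (∏ i, p (s i)) *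
      ∑ y : Fin B → Y, (∏ i : Fin B, W (blockMessage enc m₀ s i) (y i)) *
        D (s b) (blockMessage enc m₀ s b) (y b) (dec (y b)) (dec (y b')) ≤ 3 * η := by
  have hpt : ∀ s m y m₁ m₂ m₁' m₂', D s m y m₁ m₂ ≤ D s m y m₁' m₂' +
      ((if m₁ ≠ m₁' then 1 else 0) + (if m₂ ≠ m₂' then 1 else 0)) := by
    intro s m y m₁ m₂ m₁' m₂'
    have h1 := hD1 s m y m₁ m₂
    have h0 := hD0 s m y m₁' m₂'
    by_cases e1 : m₁ = m₁'
    · by_cases e2 : m₂ = m₂'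
      · simp [e1, e2]
      · simp only [e1, e2, ne_eq, not_true_eq_false, not_false_eq_true, if_true, if_false]
        subst e1
        linarith
    · simp only [e1, ne_eq, not_false_eq_true, if_true]
      split_ifs <;> linarith
  have hinner : ∀ s : Fin B → A,
      ∑ y : Fin B → Y, (∏ i : Fin B, W (blockMessage enc m₀ s i) (y i)) *
        D (s b) (blockMessage enc m₀ s b) (y b) (dec (y b)) (dec (y b')) ≤
      (∑ y, W (blockMessage enc m₀ s b) y * D (s b) (blockMessage enc m₀ s b) y
        (blockMessage enc m₀ s b) (enc (blockMessage enc m₀ s b) (s b))) + (η + η) := by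
    intro s
    have hWs : ∀ i : Fin B, IsPMF (W (blockMessage enc m₀ s i)) := fun i => hW _
    set μ : (Fin B → Y) → ℝ := fun y => ∏ i : Fin B, W (blockMessage enc m₀ s i) (y i) with hμ
    have hμ0 : ∀ y, 0 ≤ μ y := fun y => Finset.prod_nonneg fun i _ => (hWs i).1 _
    have e1 := sum_prod_mul_le_of_update hWs b
      (fun y => if dec (y b) ≠ blockMessage enc m₀ s b then 1 else 0) η
      (fun y => by simpa only [Function.update_self] using hdec (blockMessage enc m₀ s b))
    have e2 := sum_prod_mul_le_of_update hWs b'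
      (fun y => if dec (y b') ≠ blockMessage enc m₀ s b' then 1 else 0) η
      (fun y => by simpa only [Function.update_self] using hdec (blockMessage enc m₀ s b'))
    have e3 := sum_prod_mul_le_of_update hWs b
      (fun y => D (s b) (blockMessage enc m₀ s b) (y b)
        (blockMessage enc m₀ s b) (enc (blockMessage enc m₀ s b) (s b))) _
      (fun y => by simp only [Function.update_self]; exact le_rfl)
    calc _ ≤ ∑ y, μ y * (D (s b) (blockMessage enc m₀ s b) (y b)
            (blockMessage enc m₀ s b) (enc (blockMessage enc m₀ s b) (s b)) +
          ((if dec (y b) ≠ blockMessage enc m₀ s b then 1 else 0) +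
            (if dec (y b') ≠ blockMessage enc m₀ s b' then 1 else 0))) := by
          refine Finset.sum_le_sum fun y _ => mul_le_mul_of_nonneg_left ?_ (hμ0 y)
          rw [hb, blockMessage_succ]
          exact hpt _ _ _ _ _ _ _
      _ ≤ _ := by
          simp only [mul_add, Finset.sum_add_distrib]
          exact add_le_add e3 (add_le_add e1 e2)
  have e4 := sum_prod_mul_le_of_update (fun _ : Fin B => hp) b
    (fun s => ∑ y, W (blockMessage enc m₀ s b) y * D (s b) (blockMessage enc m₀ s b) y
        (blockMessage enc m₀ s b) (enc (blockMessage enc m₀ s b) (s b))) η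
    (fun s => by
      simp only [blockMessage_update, Function.update_self]
      exact hcov _)
  have h1 : ∑ s : Fin B → A, ∏ i, p (s i) = 1 := (IsPMF.pi (fun _ : Fin B => hp)).2
  calc _ ≤ ∑ s : Fin B → A, (∏ i, p (s i)) *
        ((∑ y, W (blockMessage enc m₀ s b) y * D (s b) (blockMessage enc m₀ s b) y
        (blockMessage enc m₀ s b) (enc (blockMessage enc m₀ s b) (s b))) + (η + η)) :=
        Finset.sum_le_sum fun s _ => mul_le_mul_of_nonneg_left (hinner s)
          (Finset.prod_nonneg fun i _ => hp.1 _)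
    _ ≤ 3 * η := by
        simp only [mul_add, Finset.sum_add_distrib, ← Finset.sum_mul, h1] at e4 ⊢
        linarith

/-- The blocks of a sequence of length `B * n`. -/
def blocks {A : Type*} (B n : ℕ) : (Fin (B * n) → A) ≃ (Fin B → Fin n → A) :=
  (Equiv.arrowCongr finProdFinEquiv.symm (Equiv.refl A)).trans (Equiv.curry _ _ _)

theorem blocks_apply {A : Type*} {B n : ℕ} (w : Fin (B * n) → A) (b : Fin B) (k : Fin n) :
    blocks B n w b k = w (finProdFinEquiv (b, k)) := rfl

theorem prod_eq_prod_blocks {B n : ℕ} (F : Fin (B * n) → ℝ) :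
    ∏ i, F i = ∏ b, ∏ k, F (finProdFinEquiv (b, k)) := by
  rw [← finProdFinEquiv.prod_comp, Fintype.prod_prod_type]

theorem sum_eq_sum_blocks {B n : ℕ} (F : Fin (B * n) → ℝ) :
    ∑ i, F i = ∑ b, ∑ k, F (finProdFinEquiv (b, k)) := by
  rw [← finProdFinEquiv.sum_comp, Fintype.sum_prod_type]

theorem tvDist_empDist_blocks_le {A : Type*} [Fintype A] {B n : ℕ} (hB : 0 < B) (hn : 0 < n)
    (w : Fin (B * n) → A) (P : A → ℝ) :
    tvDist (empDist w) P ≤ (∑ b, tvDist (empDist (blocks B n w b)) P) / B := by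
  classical
  have hB' : (0 : ℝ) < B := by exact_mod_cast hB
  have hn' : (0 : ℝ) < n := by exact_mod_cast hn
  have h : ∀ a, empDist w a - P a = (∑ b, (empDist (blocks B n w b) a - P a)) / B := by
    intro a
    simp only [empDist_eq, blocks_apply]
    rw [sum_eq_sum_blocks, Finset.sum_sub_distrib, ← Finset.sum_div]
    simp only [Finset.sum_const, Finset.card_univ, Fintype.card_fin, nsmul_eq_mul]
    push_cast
    field_simp
    rfl
  have h' : ∀ a, |empDist w a - P a| ≤ (∑ b, |empDist (blocks B n w b) a - P a|) / B := by
    intro a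
    rw [h, abs_div, abs_of_pos hB']
    gcongr
    exact Finset.abs_sum_le_sum_abs _ _
  calc tvDist (empDist w) P
      ≤ (∑ a, (∑ b, |empDist (blocks B n w b) a - P a|) / B) / 2 := by
        unfold tvDist
        gcongr with a
        exact h' a
    _ = (∑ b, tvDist (empDist (blocks B n w b)) P) / B := by
        simp only [tvDist]
        rw [← Finset.sum_div, ← Finset.sum_div, div_right_comm, Finset.sum_comm]

open Classical in
/-- Codes of one block: `m` is the message of the current block, `enc m s` the message of the
next one. Decoding errors and the coordination cost are at most `η` for every `m`. -/
def HasBlockCode {S X Y Z : Type*} [Fintype S] [Fintype X] [Fintype Y] [Fintype Z]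
    (PS : S → ℝ) (PYX : X → Y → ℝ) (P : S × X × Y × Z → ℝ) (η : ℝ) : Prop :=
  ∃ n : ℕ, 0 < n ∧ ∃ (M : ℕ) (_ : Fin M) (x : Fin M → Fin n → X)
    (z : Fin M → Fin M → (Fin n → Y) → Fin n → Z) (enc : Fin M → (Fin n → S) → Fin M)
    (dec : (Fin n → Y) → Fin M),
    (∀ m, ∑ y : Fin n → Y, (∏ i, PYX (x m i) (y i)) * (if dec y ≠ m then 1 else 0) ≤ η) ∧
    ∀ m, ∑ s : Fin n → S, (∏ i, PS (s i)) * ∑ y : Fin n → Y, (∏ i, PYX (x m i) (y i)) *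
      tvDist (empDist (fun i => (s i, x m i, y i, z m (enc m s) y i))) P ≤ η

theorem prob_mul_le_sum {Ω : Type*} [Fintype Ω] {P : Ω → ℝ} (hP : ∀ ω, 0 ≤ P ω) {F : Ω → ℝ}
    (hF : ∀ ω, 0 ≤ F ω) (ε : ℝ) :
    prob P {ω | ε < F ω} * ε ≤ ∑ ω, P ω * F ω := by
  classical
  unfold prob
  rw [Finset.sum_mul]
  refine Finset.sum_le_sum fun ω _ => ?_
  rw [Set.indicator_apply]
  split_ifs with h
  · exact mul_le_mul_of_nonneg_left (le_of_lt h) (hP ω)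
  · rw [zero_mul]
    exact mul_nonneg (hP ω) (hF ω)

theorem achievable_of_hasBlockCode {S X Y Z : Type*} [Fintype S] [Fintype X] [Fintype Y]
    [Fintype Z] {PS : S → ℝ} {PYX : X → Y → ℝ} (hPS : IsPMF PS) (hPYX : ∀ x, IsPMF (PYX x))
    {P : S × X × Y × Z → ℝ} (hP : IsPMF P) (h : ∀ η : ℝ, 0 < η → HasBlockCode PS PYX P η) :
    Achievable PS PYX EncoderClass.strictlyCausal P := by
  classical
  intro ε hε
  obtain ⟨n, hn, M, m₀, x, z, enc, dec, hdec, hcov⟩ := h (ε ^ 2 / 9) (by positivity)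
  obtain ⟨B, hB⟩ := exists_nat_gt (3 / ε ^ 2)
  have hB0 : (0 : ℝ) < B := lt_trans (by positivity) hB
  let msg : (Fin ((B + 1) * n) → S) → ℕ → Fin M := fun s =>
    blockMessage enc m₀ (blocks (B + 1) n s)
  let nxt : Fin (B + 1) → Fin (B + 1) := fun b => if hb : (b : ℕ) + 1 < B + 1 then ⟨b + 1, hb⟩ else b
  let f : Fin ((B + 1) * n) → (Fin ((B + 1) * n) → S) → X := fun i s =>
    x (msg s (finProdFinEquiv.symm i).1) (finProdFinEquiv.symm i).2
  let g : Fin ((B + 1) * n) → (Fin ((B + 1) * n) → Y) → Z := fun i y =>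
    z (dec (blocks (B + 1) n y (finProdFinEquiv.symm i).1))
      (dec (blocks (B + 1) n y (nxt (finProdFinEquiv.symm i).1)))
      (blocks (B + 1) n y (finProdFinEquiv.symm i).1) (finProdFinEquiv.symm i).2
  refine ⟨(B + 1) * n, by positivity, f, g, ?_, ?_⟩
  · intro i s s' hs
    obtain ⟨⟨b, k⟩, rfl⟩ := finProdFinEquiv.surjective i
    simp only [f, Equiv.symm_apply_apply]
    rw [show msg s b = msg s' b from blockMessage_congr enc m₀ b fun j hj => ?_]
    funext l
    rw [blocks_apply, blocks_apply]
    refine hs _ ?_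
    rw [Fin.lt_def]
    simp only [finProdFinEquiv_apply_val]
    have h1 := l.isLt
    have h2 : n * (j + 1) ≤ n * b := Nat.mul_le_mul_left n hj
    rw [mul_add] at h2
    omega
  · let D : (Fin n → S) → Fin M → (Fin n → Y) → Fin M → Fin M → ℝ := fun s m y m₁ m₂ =>
      tvDist (empDist (fun i => (s i, x m i, y i, z m₁ m₂ y i))) P
    let W : Fin M → (Fin n → Y) → ℝ := fun m y => ∏ i, PYX (x m i) (y i)
    have hW : ∀ m, IsPMF (W m) := fun m => IsPMF.pi fun i => hPYX _
    have hp : IsPMF (fun s : Fin n → S => ∏ i, PS (s i)) := IsPMF.pi fun _ => hPS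
    have hD0 : ∀ s m y m₁ m₂, 0 ≤ D s m y m₁ m₂ := fun _ _ _ _ _ => tvDist_nonneg _ _
    have hD1 : ∀ s m y m₁ m₂, D s m y m₁ m₂ ≤ 1 := fun _ _ _ _ _ =>
      tvDist_le_one (isPMF_empDist hn _) hP
    let C : Fin (B + 1) → (Fin (B + 1) → Fin n → S) → (Fin (B + 1) → Fin n → Y) → ℝ :=
      fun b s y => D (s b) (blockMessage enc m₀ s b) (y b) (dec (y b)) (dec (y (nxt b)))
    let E : Fin (B + 1) → ℝ := fun b =>
      ∑ s : Fin (B + 1) → Fin n → S, (∏ i, ∏ k, PS (s i k)) *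
        ∑ y : Fin (B + 1) → Fin n → Y, (∏ i : Fin (B + 1), W (blockMessage enc m₀ s i) (y i)) *
          C b s y
    have hE : ∀ b : Fin (B + 1), (b : ℕ) < B → E b ≤ 3 * (ε ^ 2 / 9) := by
      intro b hb
      have hnxt : nxt b = ⟨b + 1, by omega⟩ := dif_pos (by omega)
      exact blockMarkov_cost_le hp hW enc dec m₀ D hD0 hD1 hdec hcov b (nxt b) (by rw [hnxt])
    have hElast : E (Fin.last B) ≤ 1 := by
      refine (IsPMF.pi (fun _ : Fin (B + 1) => hp)).sum_mul_le fun s => ?_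
      exact (IsPMF.pi (fun i : Fin (B + 1) => hW (blockMessage enc m₀ s i))).sum_mul_le
        fun y => hD1 _ _ _ _ _
    have hEsum : ∑ b, E b ≤ B * (3 * (ε ^ 2 / 9)) + 1 := by
      rw [Fin.sum_univ_castSucc]
      refine add_le_add ?_ hElast
      calc _ ≤ ∑ _b : Fin B, 3 * (ε ^ 2 / 9) := Finset.sum_le_sum fun b _ => hE _ (by simp)
        _ = _ := by simp
    have hmean : ∑ sy, inducedP PS PYX f sy *
        tvDist (empDist (fun i => (sy.1 i, f i sy.1, sy.2 i, g i sy.2))) P ≤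
        (∑ b, E b) / (B + 1 : ℕ) := by
      have hpos : ∀ sy, 0 ≤ inducedP PS PYX f sy := fun sy =>
        mul_nonneg (Finset.prod_nonneg fun _ _ => hPS.1 _)
          (Finset.prod_nonneg fun _ _ => (hPYX _).1 _)
      have hstep : ∀ sy : (Fin ((B + 1) * n) → S) × (Fin ((B + 1) * n) → Y),
          inducedP PS PYX f sy *
          tvDist (empDist (fun i => (sy.1 i, f i sy.1, sy.2 i, g i sy.2))) P ≤
          (fun q : (Fin (B + 1) → Fin n → S) × (Fin (B + 1) → Fin n → Y) =>
            ((∏ i, ∏ k, PS (q.1 i k)) *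
              ∏ i : Fin (B + 1), W (blockMessage enc m₀ q.1 i) (q.2 i)) *
              ((∑ b, C b q.1 q.2) / (B + 1 : ℕ)))
            ((Equiv.prodCongr (blocks (B + 1) n) (blocks (B + 1) n)) sy) := by
        rintro ⟨s, y⟩
        refine (mul_le_mul_of_nonneg_left (tvDist_empDist_blocks_le (Nat.succ_pos B) hn _ P)
          (hpos _)).trans (le_of_eq ?_)
        congr 1
        · simp only [inducedP, prod_eq_prod_blocks]
          simp only [W, f, msg, Equiv.symm_apply_apply]
          rfl
        · congr 1
          refine Finset.sum_congr rfl fun b _ => ?_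
          simp only [C, D, Equiv.prodCongr_apply, Prod.map]
          congr 2
          funext k
          simp only [blocks_apply, f, g, msg, Equiv.symm_apply_apply]
      refine (Finset.sum_le_sum fun sy _ => hstep sy).trans (le_of_eq ?_)
      rw [Equiv.sum_comp (Equiv.prodCongr (blocks (A := S) (B + 1) n) (blocks (A := Y) (B + 1) n))
        (fun q : (Fin (B + 1) → Fin n → S) × (Fin (B + 1) → Fin n → Y) =>
          ((∏ i, ∏ k, PS (q.1 i k)) *
            ∏ i : Fin (B + 1), W (blockMessage enc m₀ q.1 i) (q.2 i)) *
            ((∑ b, C b q.1 q.2) / (B + 1 : ℕ))), Fintype.sum_prod_type]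
      have hEeq : ∑ b, E b = ∑ s : Fin (B + 1) → Fin n → S, ∑ y : Fin (B + 1) → Fin n → Y,
          ((∏ i, ∏ k, PS (s i k)) * ∏ i : Fin (B + 1), W (blockMessage enc m₀ s i) (y i)) *
            ∑ b, C b s y := by
        simp only [E, Finset.mul_sum]
        rw [Finset.sum_comm]
        refine Finset.sum_congr rfl fun s _ => ?_
        rw [Finset.sum_comm]
        refine Finset.sum_congr rfl fun y _ => Finset.sum_congr rfl fun b _ => ?_
        ring
      rw [hEeq, Finset.sum_div]
      refine Finset.sum_congr rfl fun s _ => ?_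
      rw [Finset.sum_div]
      refine Finset.sum_congr rfl fun y _ => ?_
      rw [mul_div_assoc]
    have hmark := prob_mul_le_sum (P := inducedP PS PYX f)
      (F := fun sy => tvDist (empDist (fun i => (sy.1 i, f i sy.1, sy.2 i, g i sy.2))) P)
      (fun sy => mul_nonneg (Finset.prod_nonneg fun _ _ => hPS.1 _)
          (Finset.prod_nonneg fun _ _ => (hPYX _).1 _)) (fun _ => tvDist_nonneg _ _) ε
    have hfin : (∑ b, E b) / (B + 1 : ℕ) < ε * ε := by
      rw [div_lt_iff₀ (by positivity)]
      rw [div_lt_iff₀ (by positivity)] at hB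
      push_cast
      nlinarith
    exact lt_of_mul_lt_mul_right (lt_of_le_of_lt (hmark.trans hmean) hfin) hε.le

open Classical in
/-- Derandomized covering: `M` codewords leave at most the mass that `M` independent random
codewords leave uncovered on average. -/
theorem exists_covering {A V : Type*} [Fintype A] [Fintype V] {q : V → ℝ} (hq : IsPMF q)
    (T : A → V → Prop) (M : ℕ) (w : A → ℝ) :
    ∃ v : Fin M → V, ∑ s, w s * (if ∀ j, ¬ T s (v j) then 1 else 0) ≤
      ∑ s, w s * (1 - ∑ v, q v * if T s v then 1 else 0) ^ M := by
  induction M generalizing w with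
  | zero => exact ⟨Fin.elim0, by simp⟩
  | succ M ih =>
    set t : A → ℝ := fun s => ∑ v, q v * if T s v then 1 else 0 with ht
    have hmean : ∑ v, q v * ∑ s, (w s * (1 - if T s v then 1 else 0)) * (1 - t s) ^ M ≤
        ∑ s, w s * (1 - t s) ^ (M + 1) := by
      simp only [Finset.mul_sum]
      rw [Finset.sum_comm]
      refine le_of_eq (Finset.sum_congr rfl fun s _ => ?_)
      have : 1 - t s = ∑ v, q v * (1 - if T s v then 1 else 0) := by
        simp only [mul_sub, Finset.sum_sub_distrib, mul_one, hq.2, ht]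
      rw [pow_succ]
      nth_rw 3 [this]
      rw [Finset.mul_sum, Finset.mul_sum]
      exact Finset.sum_congr rfl fun v _ => by ring
    obtain ⟨v₁, hv₁⟩ := hq.exists_le_of_sum_mul_le hmean
    obtain ⟨v, hv⟩ := ih fun s => w s * (1 - if T s v₁ then 1 else 0)
    refine ⟨Fin.cons v₁ v, le_trans (le_of_eq ?_) (hv.trans hv₁)⟩
    refine Finset.sum_congr rfl fun s _ => ?_
    rw [mul_assoc]
    congr 1
    by_cases h : T s v₁ <;> simp [Fin.forall_fin_succ, h]

theorem one_sub_pow_le {a b t : ℝ} (hb0 : 0 ≤ b) (hb1 : b ≤ 1) (ht : a * b ≤ t)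
    (ht1 : t ≤ 1) (M : ℕ) : (1 - t) ^ M ≤ 1 - b + Real.exp (-(a * M)) := by
  have h1 : (1 - t) ^ M ≤ Real.exp (-t) ^ M :=
    pow_le_pow_left₀ (by linarith) (Real.one_sub_le_exp_neg t) M
  have h2 : Real.exp (-t) ^ M ≤ Real.exp (b * (-(a * M))) := by
    rw [← Real.exp_nat_mul, Real.exp_le_exp]
    have := mul_le_mul_of_nonneg_right ht (Nat.cast_nonneg (α := ℝ) M)
    nlinarith
  have h3 : Real.exp (b * (-(a * M))) ≤ (1 - b) + b * Real.exp (-(a * M)) := by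
    have := convexOn_exp.2 (Set.mem_univ 0) (Set.mem_univ (-(a * M))) (sub_nonneg.2 hb1) hb0
      (by ring)
    simpa using this
  have h4 : b * Real.exp (-(a * M)) ≤ Real.exp (-(a * M)) :=
    mul_le_of_le_one_left (Real.exp_pos _).le hb1
  linarith

open Classical in
/-- Feinstein's maximal coding, with codewords restricted to the set `G`. -/
theorem exists_packing {X Y : Type*} [Fintype X] [Fintype Y] {r : X → ℝ} (hr : IsPMF r)
    {W : X → Y → ℝ} (hW : ∀ x, IsPMF (W x)) (G : X → Prop) (A : X → Y → Prop)
    {qY : Y → ℝ} (hqY : ∀ y, ∑ x, r x * W x y = qY y) {K : ℝ} (hK : 0 < K)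
    (hA : ∀ x y, A x y → K * qY y ≤ W x y) {η : ℝ} (hη : η ≤ 1) (M : ℕ)
    (h : ∑ x, r x * (if G x then 0 else 1) + ∑ x, r x * ∑ y, W x y * (if A x y then 0 else 1)
      + M / K < η) (k : ℕ) (hk : k ≤ M) :
    ∃ (x : ℕ → X) (dec : Y → ℕ),
      (∀ m < k, G (x m) ∧ ∑ y, W (x m) y * (if dec y ≠ m then 1 else 0) ≤ η) ∧
      ∑ y, qY y * (if dec y < k then 1 else 0) ≤ k / K := by
  have hqY0 : ∀ y, 0 ≤ qY y := fun y => by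
    rw [← hqY]
    exact Finset.sum_nonneg fun x _ => mul_nonneg (hr.1 x) ((hW x).1 y)
  induction k with
  | zero =>
    obtain ⟨x₀, -⟩ := hr.exists_le_of_sum_mul_le (F := fun _ => 0) (c := 0) (by simp)
    exact ⟨fun _ => x₀, fun _ => 0, by simp, by simp⟩
  | succ k ih =>
    obtain ⟨x, dec, hx, hmass⟩ := ih (by omega)
    have hkM : (k : ℝ) / K ≤ M / K := by
      gcongr
      omega
    have hmean : ∑ x, r x * ((if G x then 0 else 1) +
        (∑ y, W x y * (if A x y then 0 else 1) + ∑ y, W x y * (if dec y < k then 1 else 0))) ≤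
        ∑ x, r x * (if G x then 0 else 1) + ∑ x, r x * ∑ y, W x y * (if A x y then 0 else 1)
          + M / K := by
      have : ∑ x, r x * ∑ y, W x y * (if dec y < k then 1 else 0) =
          ∑ y, qY y * (if dec y < k then 1 else 0) := by
        simp only [Finset.mul_sum]
        rw [Finset.sum_comm]
        refine Finset.sum_congr rfl fun y _ => ?_
        rw [← hqY, Finset.sum_mul]
        exact Finset.sum_congr rfl fun x _ => by ring
      simp only [mul_add, Finset.sum_add_distrib]
      rw [this]
      linarith
    obtain ⟨x₁, hx₁⟩ := hr.exists_le_of_sum_mul_le hmean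
    have hx₁' := hx₁.trans_lt h
    have hn1 : 0 ≤ ∑ y, W x₁ y * (if A x₁ y then (0 : ℝ) else 1) :=
      Finset.sum_nonneg fun y _ => mul_nonneg ((hW _).1 y) (by split_ifs <;> norm_num)
    have hn2 : 0 ≤ ∑ y, W x₁ y * (if dec y < k then (1 : ℝ) else 0) :=
      Finset.sum_nonneg fun y _ => mul_nonneg ((hW _).1 y) (by split_ifs <;> norm_num)
    have hG : G x₁ := by
      by_contra hG
      rw [if_neg hG] at hx₁'
      linarith
    rw [if_pos hG, zero_add] at hx₁'
    refine ⟨fun m => if m = k then x₁ else x m,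
      fun y => if dec y < k then dec y else if A x₁ y then k else k + 1, ?_, ?_⟩
    · intro m hm
      rcases Nat.lt_succ_iff_lt_or_eq.1 hm with hlt | rfl
      · simp only [if_neg hlt.ne]
        refine ⟨(hx m hlt).1, le_trans (le_of_eq ?_) (hx m hlt).2⟩
        refine Finset.sum_congr rfl fun y _ => ?_
        congr 1
        refine if_congr ?_ rfl rfl
        split_ifs <;> omega
      · simp only [if_true]
        refine ⟨hG, le_trans ?_ hx₁'.le⟩
        rw [← Finset.sum_add_distrib]
        refine Finset.sum_le_sum fun y _ => ?_
        rw [← mul_add]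
        refine mul_le_mul_of_nonneg_left ?_ ((hW _).1 y)
        by_cases h1 : dec y < m <;> by_cases h2 : A x₁ y <;>
          simp only [h1, h2, if_true, if_false] <;> split_ifs <;> (norm_num; try omega)
    · have hAle : ∑ y, qY y * (if A x₁ y then 1 else 0) ≤ 1 / K := by
        rw [le_div_iff₀ hK, Finset.sum_mul]
        refine le_trans ?_ (hW x₁).2.le
        refine Finset.sum_le_sum fun y _ => ?_
        split_ifs with h2
        · linarith [hA _ _ h2]
        · simpa using (hW x₁).1 y
      have : ∑ y, qY y * (if (if dec y < k then dec y else if A x₁ y then k else k + 1) < k + 1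
          then (1 : ℝ) else 0) ≤ ∑ y, qY y * ((if dec y < k then 1 else 0) +
            (if A x₁ y then 1 else 0)) := by
        refine Finset.sum_le_sum fun y _ => mul_le_mul_of_nonneg_left ?_ (hqY0 y)
        by_cases h1 : dec y < k <;> by_cases h2 : A x₁ y <;>
          simp only [h1, h2, if_true, if_false] <;> split_ifs <;> (norm_num; try omega)
      refine this.trans ?_
      simp only [mul_add, Finset.sum_add_distrib]
      push_cast
      rw [add_div]
      exact add_le_add hmass hAle

open Classical in
/-- One-shot version of the code of one block. -/
theorem exists_oneShot_code {A X Y V : Type*} [Fintype A] [Fintype X] [Fintype Y] [Fintype V]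
    {p : A → ℝ} (hp : IsPMF p) {r : X → ℝ} (hr : IsPMF r) {W : X → Y → ℝ}
    (hW : ∀ x, IsPMF (W x)) {κ : X → A → V → ℝ} (hκ : ∀ x s, IsPMF (κ x s))
    {q : X → V → ℝ} (hq : ∀ x, IsPMF (q x)) {qY : Y → ℝ} (hqY : ∀ y, ∑ x, r x * W x y = qY y)
    {d : A → X → V → Y → ℝ} (hd0 : ∀ s x v y, 0 ≤ d s x v y) (hd1 : ∀ s x v y, d s x v y ≤ 1)
    {a K θ η : ℝ} (hK : 0 < K) (hη0 : 0 < η) (hη1 : η ≤ 1)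
    (hcost : ∑ x, r x * ∑ s, p s * ∑ v, κ x s v * ∑ y, W x y * d s x v y ≤ θ)
    (hcov : ∑ x, r x * ∑ s, p s * ∑ v, κ x s v * (if q x v < a * κ x s v then 1 else 0) ≤ θ)
    (hpack : ∑ x, r x * ∑ y, W x y * (if W x y < K * qY y then 1 else 0) ≤ θ)
    (M : ℕ) (hM0 : 0 < M) (haM : Real.exp (-(a * M)) ≤ η / 4) (hMK : M / K ≤ θ)
    (hθ : (θ + θ * (2 / η)) * (4 / η) + θ + θ < η) :
    ∃ (x : Fin M → X) (v : Fin M → Fin M → V) (enc : Fin M → A → Fin M) (dec : Y → Fin M),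
      (∀ m, ∑ y, W (x m) y * (if dec y ≠ m then 1 else 0) ≤ η) ∧
      ∀ m, ∑ s, p s * ∑ y, W (x m) y * d s (x m) (v m (enc m s)) y ≤ η := by
  let c : X → A → V → ℝ := fun x s v => ∑ y, W x y * d s x v y
  have hc0 : ∀ x s v, 0 ≤ c x s v := fun x s v =>
    Finset.sum_nonneg fun y _ => mul_nonneg ((hW x).1 y) (hd0 _ _ _ _)
  have hc1 : ∀ x s v, c x s v ≤ 1 := fun x s v => (hW x).sum_mul_le fun y => hd1 _ _ _ _
  obtain ⟨T, hT⟩ : ∃ T : X → A → V → Prop,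
      ∀ x s v, T x s v ↔ a * κ x s v ≤ q x v ∧ c x s v ≤ η / 2 := ⟨_, fun _ _ _ => Iff.rfl⟩
  let u : X → ℝ := fun x => ∑ s, p s * ∑ v, κ x s v * (if T x s v then 0 else 1)
  have hu0 : ∀ x, 0 ≤ u x := fun x => Finset.sum_nonneg fun s _ => mul_nonneg (hp.1 s)
    (Finset.sum_nonneg fun v _ => mul_nonneg ((hκ x s).1 v) (by split_ifs <;> norm_num))
  have hu : ∑ x, r x * u x ≤ θ + θ * (2 / η) := by
    have hTle : ∀ x s v, (if T x s v then (0 : ℝ) else 1) ≤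
        (if q x v < a * κ x s v then 1 else 0) + c x s v * (2 / η) := by
      intro x s v
      have hpos : 0 ≤ c x s v * (2 / η) := mul_nonneg (hc0 _ _ _) (by positivity)
      by_cases h1 : q x v < a * κ x s v
      · rw [if_pos h1]
        split_ifs <;> linarith
      · rw [if_neg h1, zero_add]
        split_ifs with hTx
        · exact hpos
        · have h2 : ¬ c x s v ≤ η / 2 := fun h2 => hTx ((hT _ _ _).2 ⟨not_lt.1 h1, h2⟩)
          rw [mul_div_assoc', le_div_iff₀ hη0]
          linarith
    calc ∑ x, r x * u x ≤ ∑ x, r x * ∑ s, p s * ∑ v, κ x s v *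
          ((if q x v < a * κ x s v then 1 else 0) + c x s v * (2 / η)) := by
          refine Finset.sum_le_sum fun x _ => mul_le_mul_of_nonneg_left ?_ (hr.1 x)
          refine Finset.sum_le_sum fun s _ => mul_le_mul_of_nonneg_left ?_ (hp.1 s)
          exact Finset.sum_le_sum fun v _ => mul_le_mul_of_nonneg_left (hTle x s v) ((hκ x s).1 v)
      _ = ∑ x, r x * ∑ s, p s * ∑ v, κ x s v * (if q x v < a * κ x s v then 1 else 0) +
          (∑ x, r x * ∑ s, p s * ∑ v, κ x s v * c x s v) * (2 / η) := by
          simp only [mul_add, Finset.sum_add_distrib]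
          congr 1
          simp only [Finset.mul_sum, Finset.sum_mul, mul_assoc]
      _ ≤ θ + θ * (2 / η) := by gcongr
  obtain ⟨G, hGu⟩ : ∃ G : X → Prop, ∀ x, G x ↔ u x ≤ η / 4 := ⟨_, fun _ => Iff.rfl⟩
  obtain ⟨L, hL⟩ : ∃ L : X → Y → Prop, ∀ x y, L x y ↔ ¬ W x y < K * qY y :=
    ⟨_, fun _ _ => Iff.rfl⟩
  have hG : ∑ x, r x * (if G x then 0 else 1) ≤ (θ + θ * (2 / η)) * (4 / η) := by
    calc _ ≤ ∑ x, r x * (u x * (4 / η)) := by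
          refine Finset.sum_le_sum fun x _ => mul_le_mul_of_nonneg_left ?_ (hr.1 x)
          split_ifs with hx
          · exact mul_nonneg (hu0 x) (by positivity)
          · have : ¬ u x ≤ η / 4 := fun h => hx ((hGu x).2 h)
            rw [mul_div_assoc', le_div_iff₀ hη0]
            linarith
      _ = (∑ x, r x * u x) * (4 / η) := by
          rw [Finset.sum_mul]
          exact Finset.sum_congr rfl fun x _ => by ring
      _ ≤ _ := by gcongr
  obtain ⟨x, dec, hx, -⟩ := exists_packing hr hW G L hqY hK
    (fun x y h => not_lt.1 ((hL x y).1 h)) hη1 M (lt_of_le_of_lt (by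
      refine add_le_add (add_le_add hG ?_) hMK
      simpa only [hL, ite_not] using hpack) hθ) M le_rfl
  have hcode : ∀ m : Fin M, ∃ v : Fin M → V,
      ∑ s, p s * (if ∀ j, ¬ T (x m) s (v j) then 1 else 0) ≤ η / 2 := by
    intro m
    obtain ⟨v, hv⟩ := exists_covering (hq (x m)) (T (x m)) M p
    refine ⟨v, hv.trans ?_⟩
    have hpt : ∀ s, (1 - ∑ v, q (x m) v * if T (x m) s v then 1 else 0) ^ M ≤
        ∑ v, κ (x m) s v * (if T (x m) s v then 0 else 1) + η / 4 := by
      intro s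
      have hb : ∑ v, κ (x m) s v * (if T (x m) s v then 0 else 1) =
          1 - ∑ v, κ (x m) s v * (if T (x m) s v then 1 else 0) := by
        rw [eq_sub_iff_add_eq, ← Finset.sum_add_distrib]
        refine (Finset.sum_congr rfl fun v _ => ?_).trans (hκ (x m) s).2
        split_ifs <;> ring
      rw [hb]
      refine (one_sub_pow_le (a := a)
        (b := ∑ v, κ (x m) s v * (if T (x m) s v then 1 else 0)) ?_ ?_ ?_ ?_ M).trans
        (by linarith)
      · exact Finset.sum_nonneg fun v _ => mul_nonneg ((hκ _ _).1 v) (by split_ifs <;> norm_num)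
      · exact (hκ _ _).sum_mul_le fun v => by split_ifs <;> norm_num
      · rw [Finset.mul_sum]
        refine Finset.sum_le_sum fun v _ => ?_
        split_ifs with hTx
        · simpa using ((hT _ _ _).1 hTx).1
        · simp
      · exact (hq _).sum_mul_le fun v => by split_ifs <;> norm_num
    calc _ ≤ ∑ s, p s * (∑ v, κ (x m) s v * (if T (x m) s v then 0 else 1) + η / 4) :=
          Finset.sum_le_sum fun s _ => mul_le_mul_of_nonneg_left (hpt s) (hp.1 s)
      _ = u (x m) + η / 4 := by
          simp only [mul_add, Finset.sum_add_distrib, ← Finset.sum_mul, hp.2, u, one_mul]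
      _ ≤ η / 2 := by
          have : u (x m) ≤ η / 4 := (hGu _).1 (hx m m.isLt).1
          linarith
  choose v hv using hcode
  refine ⟨fun m => x m, v,
    fun m s => if h : ∃ j, T (x m) s (v m j) then h.choose else m,
    fun y => if h : dec y < M then ⟨dec y, h⟩ else ⟨0, hM0⟩, fun m => ?_, fun m => ?_⟩ <;>
    beta_reduce
  · refine le_trans (Finset.sum_le_sum fun y _ => mul_le_mul_of_nonneg_left ?_ ((hW _).1 y))
      (hx m m.isLt).2
    by_cases h : dec y = m
    · simp [h]
    · simp only [ne_eq, h, not_false_eq_true, if_true]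
      split_ifs <;> norm_num
  · calc _ ≤ ∑ s, p s * (η / 2 + if ∀ j, ¬ T (x m) s (v m j) then 1 else 0) := by
          refine Finset.sum_le_sum fun s _ => mul_le_mul_of_nonneg_left ?_ (hp.1 s)
          by_cases h : ∃ j, T (x m) s (v m j)
          · rw [dif_pos h, if_neg (by simpa using h), add_zero]
            exact ((hT _ _ _).1 h.choose_spec).2
          · rw [if_pos (by simpa using h)]
            have := hc1 (x m) s (v m (if h : ∃ j, T (x m) s (v m j) then h.choose else m))
            linarith
      _ ≤ η := by
          simp only [mul_add, Finset.sum_add_distrib, ← Finset.sum_mul, hp.2]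
          linarith [hv m]

theorem IsPMF.prod {A B : Type*} [Fintype A] [Fintype B] {p : A → ℝ} (hp : IsPMF p)
    {g : A → B → ℝ} (hg : ∀ a, IsPMF (g a)) :
    IsPMF (fun ab : A × B => p ab.1 * g ab.1 ab.2) := by
  refine ⟨fun ab => mul_nonneg (hp.1 _) ((hg _).1 _), ?_⟩
  rw [Fintype.sum_prod_type]
  simp only [← Finset.mul_sum, (hg _).2, mul_one, hp.2]

theorem sum_prod_mul_pair {n : ℕ} {A B : Type*} [Fintype A] [Fintype B] (f : Fin n → A → ℝ)
    (g : Fin n → A → B → ℝ) (F : (Fin n → A × B) → ℝ) :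
    ∑ w : Fin n → A × B, (∏ i, f i (w i).1 * g i (w i).1 (w i).2) * F w =
      ∑ a : Fin n → A, (∏ i, f i (a i)) * ∑ b : Fin n → B, (∏ i, g i (a i) (b i)) *
        F (fun i => (a i, b i)) := by
  rw [sum_fin_prod_type]
  refine Finset.sum_congr rfl fun a _ => ?_
  rw [Finset.mul_sum]
  refine Finset.sum_congr rfl fun b _ => ?_
  rw [Finset.prod_mul_distrib, mul_assoc]

theorem HasBlockCode.mono {S X Y Z : Type*} [Fintype S] [Fintype X] [Fintype Y] [Fintype Z]
    {PS : S → ℝ} {PYX : X → Y → ℝ} {P : S × X × Y × Z → ℝ} {η η' : ℝ} (hη : η ≤ η')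
    (h : HasBlockCode PS PYX P η) : HasBlockCode PS PYX P η' := by
  obtain ⟨n, hn, M, m₀, x, z, enc, dec, h1, h2⟩ := h
  exact ⟨n, hn, M, m₀, x, z, enc, dec, fun m => (h1 m).trans hη, fun m => (h2 m).trans hη⟩

theorem HasBlockCode.of_tvDist_le {S X Y Z : Type*} [Fintype S] [Fintype X] [Fintype Y]
    [Fintype Z] {PS : S → ℝ} {PYX : X → Y → ℝ} (hPS : IsPMF PS) (hPYX : ∀ x, IsPMF (PYX x))
    {P P' : S × X × Y × Z → ℝ} {η δ : ℝ} (hδ : tvDist P' P ≤ δ) (h : HasBlockCode PS PYX P' η) :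
    HasBlockCode PS PYX P (η + δ) := by
  obtain ⟨n, hn, M, m₀, x, z, enc, dec, h1, h2⟩ := h
  have hδ0 : 0 ≤ δ := (tvDist_nonneg _ _).trans hδ
  refine ⟨n, hn, M, m₀, x, z, enc, dec, fun m => (h1 m).trans (by linarith), fun m => ?_⟩
  have hp : IsPMF (fun s : Fin n → S => ∏ i, PS (s i)) := IsPMF.pi fun _ => hPS
  have hW : IsPMF (fun y : Fin n → Y => ∏ i, PYX (x m i) (y i)) := IsPMF.pi fun _ => hPYX _
  calc _ ≤ ∑ s : Fin n → S, (∏ i, PS (s i)) * ∑ y : Fin n → Y, (∏ i, PYX (x m i) (y i)) *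
        (tvDist (empDist (fun i => (s i, x m i, y i, z m (enc m s) y i))) P' + δ) := by
        refine Finset.sum_le_sum fun s _ => mul_le_mul_of_nonneg_left ?_ (hp.1 s)
        refine Finset.sum_le_sum fun y _ => mul_le_mul_of_nonneg_left ?_ (hW.1 y)
        linarith [tvDist_triangle (empDist (fun i => (s i, x m i, y i, z m (enc m s) y i))) P' P]
    _ ≤ η + δ := by
        have e1 := hp.2
        have e2 := hW.2
        simp only [mul_add, Finset.sum_add_distrib, ← Finset.sum_mul, e1, e2, one_mul]
        linarith [h2 m]

open Classical in
theorem eventually_mean_tvDist_le {S X Y Z V : Type*} [Fintype S] [Fintype X] [Fintype Y]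
    [Fintype Z] [Fintype V] {PS : S → ℝ} {PYX : X → Y → ℝ} {PX : X → ℝ} {κ : X → S → V → ℝ}
    (hPS : IsPMF PS) (hPYX : ∀ x, IsPMF (PYX x)) (hPX : IsPMF PX) (hκ : ∀ x s, IsPMF (κ x s))
    (ζ : V → Y → Z) {P : S × X × Y × Z → ℝ}
    (hP : ∀ b, P b = ∑ w : X × S × V × Y,
      PX w.1 * (PS w.2.1 * (κ w.1 w.2.1 w.2.2.1 * PYX w.1 w.2.2.2)) *
        if (w.2.1, w.1, w.2.2.2, ζ w.2.2.1 w.2.2.2) = b then 1 else 0)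
    {θ : ℝ} (hθ : 0 < θ) :
    ∀ᶠ n : ℕ in Filter.atTop,
      ∑ x : Fin n → X, (∏ i, PX (x i)) * ∑ s : Fin n → S, (∏ i, PS (s i)) *
        ∑ v : Fin n → V, (∏ i, κ (x i) (s i) (v i)) * ∑ y : Fin n → Y, (∏ i, PYX (x i) (y i)) *
          tvDist (empDist (fun i => (s i, x i, y i, ζ (v i) (y i)))) P ≤ θ := by
  have hμ : IsPMF (fun w : X × S × V × Y =>
      PX w.1 * (PS w.2.1 * (κ w.1 w.2.1 w.2.2.1 * PYX w.1 w.2.2.2))) :=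
    hPX.prod (g := fun x (w : S × V × Y) => PS w.1 * (κ x w.1 w.2.1 * PYX x w.2.2)) fun x =>
      hPS.prod (g := fun s (w : V × Y) => κ x s w.1 * PYX x w.2) fun s =>
        (hκ x s).prod (g := fun _ y => PYX x y) fun _ => hPYX x
  filter_upwards [eventually_iid_tvDist_le hμ
    (fun w => (w.2.1, w.1, w.2.2.2, ζ w.2.2.1 w.2.2.2))
    (fun b => (hP b).trans (Finset.sum_congr rfl fun w _ => by congr)) hθ] with n hn
  rw [sum_prod_mul_pair (fun _ => PX) (fun _ x (w : S × V × Y) =>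
    PS w.1 * (κ x w.1 w.2.1 * PYX x w.2.2))] at hn
  refine le_trans (le_of_eq ?_) hn
  refine Finset.sum_congr rfl fun x _ => ?_
  rw [sum_prod_mul_pair (fun _ => PS) (fun i s (w : V × Y) => κ (x i) s w.1 * PYX (x i) w.2)]
  congr 1
  refine Finset.sum_congr rfl fun s _ => ?_
  rw [sum_prod_mul_pair (fun i => κ (x i) (s i)) (fun i _ => PYX (x i))]

open Classical in
/-- Block codes when the rate `R` needed to describe the action sequence is below the information
rate `C` of the channel. -/
theorem hasBlockCode_of_lt {S X Y Z V : Type*} [Fintype S] [Fintype X] [Fintype Y]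
    [Fintype Z] [Fintype V] {PS : S → ℝ} {PYX : X → Y → ℝ} {PX : X → ℝ} {κ : X → S → V → ℝ}
    {q : X → V → ℝ} {qY : Y → ℝ}
    (hPS : IsPMF PS) (hPYX : ∀ x, IsPMF (PYX x)) (hPX : IsPMF PX) (hκ : ∀ x s, IsPMF (κ x s))
    (hq : ∀ x, IsPMF (q x)) (hqY : ∀ y, ∑ x, PX x * PYX x y = qY y)
    (hac : ∀ x s v, 0 < PX x → 0 < PS s → 0 < κ x s v → 0 < q x v)
    (hrate : ∑ w : X × S × V, PX w.1 * (PS w.2.1 * κ w.1 w.2.1 w.2.2) *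
        Real.log (κ w.1 w.2.1 w.2.2 / q w.1 w.2.2) <
      ∑ w : X × Y, PX w.1 * PYX w.1 w.2 * Real.log (PYX w.1 w.2 / qY w.2))
    (hcap : 0 < ∑ w : X × Y, PX w.1 * PYX w.1 w.2 * Real.log (PYX w.1 w.2 / qY w.2))
    (ζ : V → Y → Z) {P : S × X × Y × Z → ℝ} (hPpmf : IsPMF P)
    (hP : ∀ b, P b = ∑ w : X × S × V × Y,
      PX w.1 * (PS w.2.1 * (κ w.1 w.2.1 w.2.2.1 * PYX w.1 w.2.2.2)) *
        if (w.2.1, w.1, w.2.2.2, ζ w.2.2.1 w.2.2.2) = b then 1 else 0)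
    {η : ℝ} (hη0 : 0 < η) : HasBlockCode PS PYX P η := by
  wlog hη1 : η ≤ 1 generalizing η
  · exact (this one_pos le_rfl).mono (not_le.1 hη1).le
  set J := ∑ w : X × S × V, PX w.1 * (PS w.2.1 * κ w.1 w.2.1 w.2.2) *
        Real.log (κ w.1 w.2.1 w.2.2 / q w.1 w.2.2) with hJ
  set C := ∑ w : X × Y, PX w.1 * PYX w.1 w.2 * Real.log (PYX w.1 w.2 / qY w.2) with hC
  set m := max J 0 with hm
  have hmC : m < C := max_lt hrate hcap
  have hm0 : 0 ≤ m := le_max_right _ _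
  have hJm : J ≤ m := le_max_left _ _
  set δ := (C - m) / 4 with hδ
  have hδ0 : 0 < δ := by rw [hδ]; linarith
  have hCδ : C = m + 4 * δ := by rw [hδ]; ring
  set θ := η ^ 3 / 40 with hθ
  have hθ0 : 0 < θ := by positivity
  have hμ3 : IsPMF (fun w : X × S × V => PX w.1 * (PS w.2.1 * κ w.1 w.2.1 w.2.2)) :=
    hPX.prod (g := fun x (w : S × V) => PS w.1 * κ x w.1 w.2) fun x =>
      hPS.prod (g := fun s v => κ x s v) fun s => hκ x s
  have hμ2 : IsPMF (fun w : X × Y => PX w.1 * PYX w.1 w.2) := hPX.prod hPYX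
  have hpos : ∀ {a b : ℝ}, 0 ≤ a → 0 ≤ b → 0 < a * b → 0 < a ∧ 0 < b := fun ha hb h =>
    ⟨pos_of_mul_pos_left h hb, pos_of_mul_pos_right h ha⟩
  have hκpos : ∀ w : X × S × V, 0 < PX w.1 * (PS w.2.1 * κ w.1 w.2.1 w.2.2) →
      0 < PX w.1 ∧ 0 < PS w.2.1 ∧ 0 < κ w.1 w.2.1 w.2.2 := fun w h =>
    have h1 := hpos (hPX.1 _) (mul_nonneg (hPS.1 _) ((hκ _ _).1 _)) h
    ⟨h1.1, hpos (hPS.1 _) ((hκ _ _).1 _) h1.2⟩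
  have hev1 := eventually_mean_tvDist_le hPS hPYX hPX hκ ζ hP hθ0
  have hev2 := eventually_iid_likelihood_le hμ3 (fun w => κ w.1 w.2.1 w.2.2)
    (fun w => q w.1 w.2.2) (fun w h => (hκpos w h).2.2)
    (fun w h => hac _ _ _ (hκpos w h).1 (hκpos w h).2.1 (hκpos w h).2.2)
    (R := m + δ) (by rw [← hJ]; linarith) hθ0
  have hev3 := eventually_iid_likelihood_le hμ2 (fun w => qY w.2) (fun w => PYX w.1 w.2)
    (fun w h => by
      rw [← hqY]
      exact lt_of_lt_of_le h (Finset.single_le_sum (f := fun x => PX x * PYX x w.2)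
        (fun x _ => mul_nonneg (hPX.1 x) ((hPYX x).1 _)) (Finset.mem_univ w.1)))
    (fun w h => (hpos (hPX.1 _) ((hPYX _).1 _) h).2)
    (R := -(m + 3 * δ)) (by
      have : ∑ w : X × Y, PX w.1 * PYX w.1 w.2 * Real.log (qY w.2 / PYX w.1 w.2) = -C := by
        rw [hC, ← Finset.sum_neg_distrib]
        refine Finset.sum_congr rfl fun w _ => ?_
        rw [← inv_div, Real.log_inv]
        ring
      rw [this]
      linarith) hθ0
  have hev4 : ∀ᶠ n : ℕ in Filter.atTop, Real.exp (-(n * δ)) ≤ min (η / 4) (θ / 2) := by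
    have h1 : Filter.Tendsto (fun n : ℕ => Real.exp (-(n * δ))) Filter.atTop (nhds 0) :=
      Real.tendsto_exp_neg_atTop_nhds_zero.comp
        (tendsto_natCast_atTop_atTop.atTop_mul_const hδ0)
    exact h1.eventually_le_const (by positivity)
  obtain ⟨n, ⟨⟨⟨h1, h2⟩, h3⟩, h4⟩, hn⟩ := ((((hev1.and hev2).and hev3).and hev4).and
    (Filter.eventually_gt_atTop 0)).exists
  set M := ⌈Real.exp (n * (m + 2 * δ))⌉₊ with hM
  have hMlow : Real.exp (n * (m + 2 * δ)) ≤ M := Nat.le_ceil _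
  have hMup : (M : ℝ) ≤ 2 * Real.exp (n * (m + 2 * δ)) := by
    have e1 := (Nat.ceil_lt_add_one (Real.exp_pos (n * (m + 2 * δ))).le).le
    have e2 : 1 ≤ Real.exp (n * (m + 2 * δ)) := Real.one_le_exp (by positivity)
    linarith
  have hM0 : 0 < M := Nat.ceil_pos.2 (Real.exp_pos _)
  have haM : Real.exp (-(Real.exp (-(n * (m + δ))) * M)) ≤ η / 4 := by
    refine le_trans (Real.exp_le_exp.2 ?_) (h4.trans (min_le_left _ _))
    have e1 : Real.exp (-(n * (m + δ))) * Real.exp (n * (m + 2 * δ)) = Real.exp (n * δ) := by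
      rw [← Real.exp_add]
      ring_nf
    have e2 := mul_le_mul_of_nonneg_left hMlow (Real.exp_pos (-(n * (m + δ)))).le
    have e3 := Real.add_one_le_exp (n * δ)
    linarith
  have hMK : (M : ℝ) / Real.exp (n * (m + 3 * δ)) ≤ θ := by
    rw [div_le_iff₀ (Real.exp_pos _)]
    have e1 : Real.exp (-(n * δ)) * Real.exp (n * (m + 3 * δ)) = Real.exp (n * (m + 2 * δ)) := by
      rw [← Real.exp_add]
      ring_nf
    have e2 := mul_le_mul_of_nonneg_right (h4.trans (min_le_right _ _))
      (Real.exp_pos (n * (m + 3 * δ))).le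
    linarith
  have hθη : (θ + θ * (2 / η)) * (4 / η) + θ + θ < η := by
    have : (θ + θ * (2 / η)) * (4 / η) + θ + θ = η * (1 / 5 + η / 10 + η ^ 2 / 20) := by
      rw [hθ]
      field_simp
      ring
    rw [this]
    nlinarith
  have hcov : ∑ x : Fin n → X, (∏ i, PX (x i)) * ∑ s : Fin n → S, (∏ i, PS (s i)) *
      ∑ v : Fin n → V, (∏ i, κ (x i) (s i) (v i)) *
        (if ∏ i, q (x i) (v i) < Real.exp (-(n * (m + δ))) * ∏ i, κ (x i) (s i) (v i)
          then 1 else 0) ≤ θ := by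
    rw [sum_prod_mul_pair (fun _ => PX) (fun _ x (w : S × V) => PS w.1 * κ x w.1 w.2)] at h2
    refine le_trans (le_of_eq ?_) h2
    refine Finset.sum_congr rfl fun x _ => ?_
    rw [sum_prod_mul_pair (fun _ => PS) (fun i s v => κ (x i) s v)]
    congr 1
    refine Finset.sum_congr rfl fun s _ => ?_
    congr 1
    refine Finset.sum_congr rfl fun v _ => ?_
    congr 1
    refine if_congr ?_ rfl rfl
    rw [Real.exp_neg, inv_mul_eq_div, lt_div_iff₀' (Real.exp_pos _)]
  have hpack : ∑ x : Fin n → X, (∏ i, PX (x i)) * ∑ y : Fin n → Y, (∏ i, PYX (x i) (y i)) *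
      (if ∏ i, PYX (x i) (y i) < Real.exp (n * (m + 3 * δ)) * ∏ i, qY (y i)
        then 1 else 0) ≤ θ := by
    rw [sum_prod_mul_pair (fun _ => PX) (fun _ => PYX)] at h3
    refine le_trans (le_of_eq ?_) h3
    refine Finset.sum_congr rfl fun x _ => ?_
    congr 1
    refine Finset.sum_congr rfl fun y _ => ?_
    congr 1
    refine if_congr ?_ rfl rfl
    rw [mul_neg, Real.exp_neg, inv_mul_eq_div, div_lt_iff₀' (Real.exp_pos _)]
  obtain ⟨x, v, enc, dec, hdec, hcost⟩ := exists_oneShot_code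
    (p := fun s : Fin n → S => ∏ i, PS (s i)) (IsPMF.pi fun _ => hPS)
    (r := fun x : Fin n → X => ∏ i, PX (x i)) (IsPMF.pi fun _ => hPX)
    (W := fun (x : Fin n → X) (y : Fin n → Y) => ∏ i, PYX (x i) (y i))
    (fun x => IsPMF.pi fun _ => hPYX _)
    (κ := fun (x : Fin n → X) (s : Fin n → S) (v : Fin n → V) => ∏ i, κ (x i) (s i) (v i))
    (fun x s => IsPMF.pi fun _ => hκ _ _)
    (q := fun (x : Fin n → X) (v : Fin n → V) => ∏ i, q (x i) (v i))
    (fun x => IsPMF.pi fun _ => hq _)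
    (qY := fun y : Fin n → Y => ∏ i, qY (y i))
    (fun y => by
      have e := Finset.prod_univ_sum (fun _ : Fin n => (Finset.univ : Finset X))
        (fun i x => PX x * PYX x (y i))
      rw [Fintype.piFinset_univ] at e
      simp only [hqY, Finset.prod_mul_distrib] at e
      exact e.symm)
    (d := fun s x v y => tvDist (empDist (fun i => (s i, x i, y i, ζ (v i) (y i)))) P)
    (fun _ _ _ _ => tvDist_nonneg _ _)
    (fun _ _ _ _ => tvDist_le_one (isPMF_empDist hn _) hPpmf)
    (Real.exp_pos _) hη0 hη1 h1 hcov hpack M hM0 haM hMK hθη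
  exact ⟨n, hn, M, ⟨0, hM0⟩, x, fun m m' y i => ζ (v m m' i) (y i), enc, dec, hdec, hcost⟩

open Classical in
/-- Block codes with a single message, when the actions do not depend on the source. -/
theorem hasBlockCode_of_indep {S X Y Z V : Type*} [Fintype S] [Fintype X] [Fintype Y]
    [Fintype Z] [Fintype V] {PS : S → ℝ} {PYX : X → Y → ℝ} {PX : X → ℝ} {q : X → V → ℝ}
    (hPS : IsPMF PS) (hPYX : ∀ x, IsPMF (PYX x)) (hPX : IsPMF PX) (hq : ∀ x, IsPMF (q x))
    (ζ : V → Y → Z) {P : S × X × Y × Z → ℝ}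
    (hP : ∀ b, P b = ∑ w : X × S × V × Y,
      PX w.1 * (PS w.2.1 * (q w.1 w.2.2.1 * PYX w.1 w.2.2.2)) *
        if (w.2.1, w.1, w.2.2.2, ζ w.2.2.1 w.2.2.2) = b then 1 else 0)
    {η : ℝ} (hη0 : 0 < η) : HasBlockCode PS PYX P η := by
  obtain ⟨n, h, hn⟩ := ((eventually_mean_tvDist_le (κ := fun x _ => q x) hPS hPYX hPX
    (fun x _ => hq x) ζ hP hη0).and (Filter.eventually_gt_atTop 0)).exists
  obtain ⟨x, hx⟩ := (IsPMF.pi fun _ : Fin n => hPX).exists_le_of_sum_mul_le h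
  have hx' : ∑ v : Fin n → V, (∏ i, q (x i) (v i)) * ∑ s : Fin n → S, (∏ i, PS (s i)) *
      ∑ y : Fin n → Y, (∏ i, PYX (x i) (y i)) *
        tvDist (empDist (fun i => (s i, x i, y i, ζ (v i) (y i)))) P ≤ η := by
    refine le_trans (le_of_eq ?_) hx
    simp only [Finset.mul_sum]
    rw [Finset.sum_comm]
    refine Finset.sum_congr rfl fun s _ => Finset.sum_congr rfl fun v _ =>
      Finset.sum_congr rfl fun y _ => ?_
    ring
  obtain ⟨v, hv⟩ := (IsPMF.pi fun i : Fin n => hq (x i)).exists_le_of_sum_mul_le hx'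
  refine ⟨n, hn, 1, 0, fun _ => x, fun _ _ y i => ζ (v i) (y i), fun _ _ => 0, fun _ => 0,
    fun m => ?_, fun _ => hv⟩
  simpa [Subsingleton.elim m 0] using hη0.le

theorem sum_prod_mul_ite_apply {ι A : Type*} [Fintype ι] [DecidableEq ι] [Fintype A]
    [DecidableEq A] {p : ι → A → ℝ} (hp : ∀ i, IsPMF (p i)) (b : ι) (a : A) :
    ∑ w : ι → A, (∏ i, p i (w i)) * (if w b = a then 1 else 0) = p b a := by
  refine le_antisymm (sum_prod_mul_le_of_update hp b _ _ fun s => by simp) ?_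
  have h := sum_prod_mul_le_of_update hp b (fun w => -(if w b = a then 1 else 0)) (-p b a)
    fun s => by simp
  simpa using h

open Classical in
theorem sum_mul_ite_law_eq {S X Y Z V : Type*} [Fintype S] [Fintype X] [Fintype Y] [Fintype V]
    (PX : X → ℝ) (PS : S → ℝ) (κ : X → S → V → ℝ) (PYX : X → Y → ℝ) (ζ : V → Y → Z)
    (s : S) (x : X) (y : Y) (z : Z) :
    (∑ w : X × S × V × Y, PX w.1 * (PS w.2.1 * (κ w.1 w.2.1 w.2.2.1 * PYX w.1 w.2.2.2)) *
        if (w.2.1, w.1, w.2.2.2, ζ w.2.2.1 w.2.2.2) = (s, x, y, z) then 1 else 0) =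
      PS s * (PX x * (PYX x y * ∑ v, κ x s v * if ζ v y = z then 1 else 0)) := by
  simp only [Fintype.sum_prod_type, Prod.mk.injEq, ite_and, mul_ite, mul_one, mul_zero]
  rw [Finset.sum_eq_single x (fun x' _ h => by simp [h]) (by simp),
    Finset.sum_eq_single s (fun s' _ h => by simp [h]) (by simp)]
  simp only [if_true]
  simp only [Finset.mul_sum]
  refine Finset.sum_congr rfl fun v _ => ?_
  rw [Finset.sum_eq_single y (fun y' _ h => by simp [h]) (by simp)]
  simp only [if_true]
  split_ifs <;> ring

theorem margProb_eq_sum_ite {Ω A : Type*} [Fintype Ω] [DecidableEq A] (P : Ω → ℝ) (f : Ω → A)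
    (a : A) : margProb P f a = ∑ ω, if f ω = a then P ω else 0 := by
  simp [margProb, prob, Set.indicator_apply]

/-- Equality case of Gibbs' inequality. -/
theorem eq_of_sum_mul_log_div_nonpos {A : Type*} [Fintype A] {p q : A → ℝ} (hp : IsPMF p)
    (hq : IsPMF q) (hac : ∀ a, q a = 0 → p a = 0)
    (h : ∑ a, p a * Real.log (p a / q a) ≤ 0) (a : A) : p a = q a := by
  have hterm : ∀ a, q a * InformationTheory.klFun (p a / q a) =
      p a * Real.log (p a / q a) + (q a - p a) := by
    intro a
    rw [InformationTheory.klFun_apply]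
    rcases eq_or_ne (q a) 0 with h0 | h0
    · simp [h0, hac a h0]
    · field_simp
      ring
  have hnn : ∀ a, 0 ≤ q a * InformationTheory.klFun (p a / q a) := fun a =>
    mul_nonneg (hq.1 a) (InformationTheory.klFun_nonneg (div_nonneg (hp.1 a) (hq.1 a)))
  have hsum : ∑ a, q a * InformationTheory.klFun (p a / q a) = 0 := by
    refine le_antisymm ?_ (Finset.sum_nonneg fun a _ => hnn a)
    simp only [hterm, Finset.sum_add_distrib, Finset.sum_sub_distrib, hp.2, hq.2]
    linarith
  have h0 := (Finset.sum_eq_zero_iff_of_nonneg fun a _ => hnn a).1 hsum a (Finset.mem_univ a)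
  rcases mul_eq_zero.1 h0 with h1 | h1
  · rw [h1, hac a h1]
  · rw [InformationTheory.klFun_eq_zero_iff (div_nonneg (hp.1 a) (hq.1 a))] at h1
    have : q a ≠ 0 := fun h2 => by simp [h2] at h1
    field_simp at h1
    exact h1

/-- Mixing a pmf with an extra symbol of mass `δ`. -/
def mixNone {V : Type*} (δ : ℝ) (p : V → ℝ) : Option V → ℝ
  | none => δ
  | some v => (1 - δ) * p v

theorem IsPMF.mixNone {V : Type*} [Fintype V] {p : V → ℝ} (hp : IsPMF p) {δ : ℝ} (h0 : 0 ≤ δ)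
    (h1 : δ ≤ 1) : IsPMF (mixNone δ p) := by
  refine ⟨fun o => ?_, ?_⟩
  · cases o with
    | none => exact h0
    | some v => exact mul_nonneg (by linarith) (hp.1 v)
  · simp only [Fintype.sum_option, _root_.mixNone, ← Finset.mul_sum, hp.2]
    ring

theorem sum_mixNone_mul_log {V : Type*} [Fintype V] (p q : V → ℝ) {δ : ℝ} (h0 : 0 < δ)
    (h1 : δ < 1) :
    ∑ o, mixNone δ p o * Real.log (mixNone δ p o / mixNone δ q o) =
      (1 - δ) * ∑ v, p v * Real.log (p v / q v) := by
  have h2 : 1 - δ ≠ 0 := by linarith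
  simp only [Fintype.sum_option, mixNone, div_self h0.ne', Real.log_one, mul_zero, zero_add,
    Finset.mul_sum]
  refine Finset.sum_congr rfl fun v _ => ?_
  rw [mul_div_mul_left _ _ h2, mul_assoc]

theorem sum_mul_mul_log_mul_div {V W : Type*} [Fintype V] [Fintype W] (p q : V → ℝ)
    {Φ : V → W → ℝ} (hΦ : ∀ v, IsPMF (Φ v)) :
    ∑ vw : V × W, p vw.1 * Φ vw.1 vw.2 *
        Real.log (p vw.1 * Φ vw.1 vw.2 / (q vw.1 * Φ vw.1 vw.2)) =
      ∑ v, p v * Real.log (p v / q v) := by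
  rw [Fintype.sum_prod_type]
  refine Finset.sum_congr rfl fun v _ => ?_
  calc _ = ∑ w, p v * Real.log (p v / q v) * Φ v w := by
        refine Finset.sum_congr rfl fun w _ => ?_
        rcases eq_or_ne (Φ v w) 0 with h | h
        · simp [h]
        · simp only [mul_div_mul_right _ _ h]
          ring
    _ = _ := by rw [← Finset.mul_sum, (hΦ v).2, mul_one]

theorem margProb_action_eq {S X Y Z V : Type*} [Fintype S] [Fintype X] [Fintype Y] [Fintype Z]
    [Fintype V] {PS : S → ℝ} {PYX : X → Y → ℝ} {PX : X → ℝ} {κ : X → S → V → ℝ}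
    {PZ : V → Y → Z → ℝ} (hPYX : ∀ x, IsPMF (PYX x)) (hPZ : ∀ v y, IsPMF (PZ v y))
    {Q : S × X × Y × Z × V → ℝ}
    (hQ : ∀ s x y z v, Q (s, x, y, z, v) = PS s * PX x * κ x s v * PYX x y * PZ v y z)
    (x : X) (v : V) :
    margProb Q (fun ω => (ω.2.1, ω.2.2.2.2)) (x, v) = PX x * ∑ s, PS s * κ x s v := by
  classical
  rw [margProb_eq_sum_ite]
  simp only [Fintype.sum_prod_type, Prod.mk.injEq, hQ, Finset.mul_sum]
  refine Finset.sum_congr rfl fun s _ => ?_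
  rw [Finset.sum_eq_single x (fun x' _ h => by simp [h]) (by simp)]
  simp only [true_and, Finset.sum_ite_eq', Finset.mem_univ, if_true,
    ← Finset.mul_sum, (hPZ _ _).2, (hPYX _).2, mul_one]
  ring

theorem mutInfo_source_eq {S X Y Z V : Type*} [Fintype S] [Fintype X] [Fintype Y] [Fintype Z]
    [Fintype V] {PS : S → ℝ} {PYX : X → Y → ℝ} {PX : X → ℝ} {κ : X → S → V → ℝ}
    {PZ : V → Y → Z → ℝ} (hPYX : ∀ x, IsPMF (PYX x)) (hPX : IsPMF PX)
    (hκ : ∀ x s, IsPMF (κ x s)) (hPZ : ∀ v y, IsPMF (PZ v y)) {Q : S × X × Y × Z × V → ℝ}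
    (hQ : ∀ s x y z v, Q (s, x, y, z, v) = PS s * PX x * κ x s v * PYX x y * PZ v y z) :
    mutInfo Q (fun ω => (ω.2.1, ω.2.2.2.2)) (fun ω => ω.1) =
      (∑ w : X × S × V, PX w.1 * (PS w.2.1 * κ w.1 w.2.1 w.2.2) *
        Real.log (κ w.1 w.2.1 w.2.2 / ∑ s, PS s * κ w.1 s w.2.2)) / Real.log 2 := by
  classical
  have e1 : ∀ x v s, margProb Q (fun ω => ((ω.2.1, ω.2.2.2.2), ω.1)) ((x, v), s) =
      PX x * (PS s * κ x s v) := by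
    intro x v s
    rw [margProb_eq_sum_ite]
    simp only [Fintype.sum_prod_type, Prod.mk.injEq, hQ]
    rw [Finset.sum_eq_single s (fun s' _ h => by simp [h]) (by simp),
      Finset.sum_eq_single x (fun x' _ h => by simp [h]) (by simp)]
    simp only [true_and, and_true, Finset.sum_ite_eq', Finset.mem_univ, if_true,
      ← Finset.mul_sum, (hPZ _ _).2, (hPYX _).2, mul_one]
    ring
  have e2 := margProb_action_eq hPYX hPZ hQ
  have e3 : ∀ s, margProb Q (fun ω => ω.1) s = PS s := by
    intro s
    rw [margProb_eq_sum_ite]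
    simp only [Fintype.sum_prod_type, hQ]
    rw [Finset.sum_eq_single s (fun s' _ h => by simp [h]) (by simp)]
    simp only [if_true]
    calc _ = ∑ x, ∑ y, ∑ v, PS s * PX x * κ x s v * PYX x y := by
          refine Finset.sum_congr rfl fun x _ => Finset.sum_congr rfl fun y _ => ?_
          rw [Finset.sum_comm]
          simp only [← Finset.mul_sum, (hPZ _ _).2, mul_one]
      _ = PS s := by
          simp only [← Finset.sum_mul, ← Finset.mul_sum, (hκ _ _).2, (hPYX _).2, hPX.2, mul_one]
  have hterm : ∀ x v s, PX x * (PS s * κ x s v) * Real.logb 2 (PX x * (PS s * κ x s v) /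
      (PX x * (∑ s, PS s * κ x s v) * PS s)) = PX x * (PS s * κ x s v) *
        Real.log (κ x s v / ∑ s, PS s * κ x s v) / Real.log 2 := by
    intro x v s
    rcases eq_or_ne (PX x) 0 with h | h
    · simp [h]
    rcases eq_or_ne (PS s) 0 with h' | h'
    · simp [h']
    rw [show PX x * (PS s * κ x s v) = PX x * PS s * κ x s v by ring,
      show PX x * (∑ s, PS s * κ x s v) * PS s = PX x * PS s * ∑ s, PS s * κ x s v by ring,
      mul_div_mul_left _ _ (mul_ne_zero h h'), Real.logb, mul_div_assoc]
  simp only [mutInfo, Fintype.sum_prod_type, e1, e2, e3, hterm, Finset.sum_div]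
  exact Finset.sum_congr rfl fun x _ => Finset.sum_comm

theorem mutInfo_channel_eq {S X Y Z V : Type*} [Fintype S] [Fintype X] [Fintype Y] [Fintype Z]
    [Fintype V] {PS : S → ℝ} {PYX : X → Y → ℝ} {PX : X → ℝ} {κ : X → S → V → ℝ}
    {PZ : V → Y → Z → ℝ} (hPS : IsPMF PS) (hPYX : ∀ x, IsPMF (PYX x))
    (hκ : ∀ x s, IsPMF (κ x s)) (hPZ : ∀ v y, IsPMF (PZ v y)) {Q : S × X × Y × Z × V → ℝ}
    (hQ : ∀ s x y z v, Q (s, x, y, z, v) = PS s * PX x * κ x s v * PYX x y * PZ v y z) :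
    mutInfo Q (fun ω => (ω.2.1, ω.2.2.2.2)) (fun ω => ω.2.2.1) =
      (∑ w : X × Y, PX w.1 * PYX w.1 w.2 *
        Real.log (PYX w.1 w.2 / ∑ x, PX x * PYX x w.2)) / Real.log 2 := by
  classical
  have hκ' : ∀ x, ∑ v, ∑ s, PS s * κ x s v = 1 := fun x => by
    rw [Finset.sum_comm]
    simp only [← Finset.mul_sum, (hκ _ _).2, mul_one, hPS.2]
  have e1 : ∀ x v y, margProb Q (fun ω => ((ω.2.1, ω.2.2.2.2), ω.2.2.1)) ((x, v), y) =
      PX x * (∑ s, PS s * κ x s v) * PYX x y := by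
    intro x v y
    rw [margProb_eq_sum_ite]
    simp only [Fintype.sum_prod_type, Prod.mk.injEq, hQ, Finset.mul_sum, Finset.sum_mul]
    refine Finset.sum_congr rfl fun s _ => ?_
    rw [Finset.sum_eq_single x (fun x' _ h => by simp [h]) (by simp),
      Finset.sum_eq_single y (fun y' _ h => by simp [h]) (by simp)]
    simp only [true_and, and_true, Finset.sum_ite_eq', Finset.mem_univ, if_true,
      ← Finset.mul_sum, (hPZ _ _).2]
    ring
  have e2 := margProb_action_eq hPYX hPZ hQ
  have e3 : ∀ y, margProb Q (fun ω => ω.2.2.1) y = ∑ x, PX x * PYX x y := by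
    intro y
    rw [margProb_eq_sum_ite]
    simp only [Fintype.sum_prod_type, hQ]
    rw [Finset.sum_comm]
    refine Finset.sum_congr rfl fun x _ => ?_
    calc _ = ∑ s, ∑ v, PS s * PX x * κ x s v * PYX x y := by
          refine Finset.sum_congr rfl fun s _ => ?_
          rw [Finset.sum_eq_single y (fun y' _ h => by simp [h]) (by simp), Finset.sum_comm]
          simp only [if_true, ← Finset.mul_sum, (hPZ _ _).2, mul_one]
      _ = _ := by
          simp only [← Finset.sum_mul, ← Finset.mul_sum, (hκ _ _).2, hPS.2, mul_one, one_mul]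
  have hterm : ∀ x v y, PX x * (∑ s, PS s * κ x s v) * PYX x y *
      Real.logb 2 (PX x * (∑ s, PS s * κ x s v) * PYX x y /
        (PX x * (∑ s, PS s * κ x s v) * ∑ x, PX x * PYX x y)) =
      (∑ s, PS s * κ x s v) * (PX x * PYX x y *
        Real.log (PYX x y / ∑ x, PX x * PYX x y) / Real.log 2) := by
    intro x v y
    rcases eq_or_ne (PX x * ∑ s, PS s * κ x s v) 0 with h | h
    · rcases mul_eq_zero.1 h with h' | h' <;> simp [h']
    rw [mul_div_mul_left _ _ h, Real.logb]
    ring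
  simp only [mutInfo, Fintype.sum_prod_type, e1, e2, e3, hterm, Finset.sum_div]
  refine Finset.sum_congr rfl fun x _ => ?_
  rw [Finset.sum_comm]
  refine Finset.sum_congr rfl fun y _ => ?_
  rw [← Finset.sum_mul, hκ', one_mul]

theorem tvDist_convex_combination_le {A : Type*} [Fintype A] {P P' R : A → ℝ} (hP : IsPMF P)
    (hR : IsPMF R) {δ : ℝ} (hδ : 0 ≤ δ) (h : ∀ a, P' a = (1 - δ) * P a + δ * R a) :
    tvDist P' P ≤ δ := by
  have e : tvDist P' P = δ * tvDist R P := by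
    simp only [tvDist]
    rw [← mul_div_assoc, Finset.mul_sum]
    congr 1
    refine Finset.sum_congr rfl fun a _ => ?_
    rw [h, show (1 - δ) * P a + δ * R a - P a = δ * (R a - P a) by ring, abs_mul, abs_of_nonneg hδ]
  rw [e]
  exact mul_le_of_le_one_right hδ (tvDist_le_one hR hP)

theorem IsPMF.sum_mul {A B : Type*} [Fintype A] [Fintype B] {p : A → ℝ} (hp : IsPMF p)
    {g : A → B → ℝ} (hg : ∀ a, IsPMF (g a)) : IsPMF (fun b => ∑ a, p a * g a b) := by
  refine ⟨fun b => Finset.sum_nonneg fun a _ => mul_nonneg (hp.1 a) ((hg a).1 b), ?_⟩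
  rw [Finset.sum_comm]
  simp only [← Finset.mul_sum, (hg _).2, mul_one, hp.2]

theorem IsPMF.exists_pos {A : Type*} [Fintype A] {p : A → ℝ} (hp : IsPMF p) : ∃ a, 0 < p a := by
  by_contra! h
  have h1 := hp.2
  have h2 : ∑ a, p a ≤ 0 := Finset.sum_nonpos fun a _ => h a
  linarith

theorem isPMF_source_action_channel {S X Y Z : Type*} [Fintype S] [Fintype X] [Fintype Y]
    [Fintype Z] {PS : S → ℝ} {PX : X → ℝ} {PYX : X → Y → ℝ} {r : S → X → Y → Z → ℝ}
    (hPS : IsPMF PS) (hPX : IsPMF PX) (hPYX : ∀ x, IsPMF (PYX x))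
    (hr : ∀ s x y, IsPMF (r s x y)) {P : S × X × Y × Z → ℝ}
    (hP : ∀ s x y z, P (s, x, y, z) = PS s * (PX x * (PYX x y * r s x y z))) : IsPMF P := by
  have e : P = fun w => PS w.1 * (PX w.2.1 * (PYX w.2.1 w.2.2.1 * r w.1 w.2.1 w.2.2.1 w.2.2.2)) :=
    funext fun w => hP _ _ _ _
  rw [e]
  exact hPS.prod (g := fun s (w : X × Y × Z) => PX w.1 * (PYX w.1 w.2.1 * r s w.1 w.2.1 w.2.2))
    fun s => hPX.prod (g := fun x (w : Y × Z) => PYX x w.1 * r s x w.1 w.2)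
      fun x => (hPYX x).prod (g := r s x) fun y => hr s x y

/-- Block codes for the law in which the reconstruction is generated from the action `V` and the
channel output. -/
theorem hasBlockCode_of_rate_le {S X Y Z V : Type*} [Fintype S] [Fintype X] [Fintype Y]
    [Fintype Z] [Fintype V] {PS : S → ℝ} {PYX : X → Y → ℝ} {PX : X → ℝ} {κ : X → S → V → ℝ}
    {PZ : V → Y → Z → ℝ} (hPS : IsPMF PS) (hPYX : ∀ x, IsPMF (PYX x)) (hPX : IsPMF PX)
    (hκ : ∀ x s, IsPMF (κ x s)) (hPZ : ∀ v y, IsPMF (PZ v y))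
    (hrate : ∑ w : X × S × V, PX w.1 * (PS w.2.1 * κ w.1 w.2.1 w.2.2) *
        Real.log (κ w.1 w.2.1 w.2.2 / ∑ s, PS s * κ w.1 s w.2.2) ≤
      ∑ w : X × Y, PX w.1 * PYX w.1 w.2 * Real.log (PYX w.1 w.2 / ∑ x, PX x * PYX x w.2))
    {P : S × X × Y × Z → ℝ}
    (hP : ∀ s x y z, P (s, x, y, z) = PS s * (PX x * (PYX x y * ∑ v, κ x s v * PZ v y z)))
    {η : ℝ} (hη : 0 < η) : HasBlockCode PS PYX P η := by
  classical
  have hP1 : IsPMF P := isPMF_source_action_channel hPS hPX hPYX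
    (fun s x y => (hκ x s).sum_mul fun v => hPZ v y) hP
  obtain ⟨δ, hδ0, hδ1, hδη⟩ : ∃ δ : ℝ, 0 < δ ∧ δ < 1 ∧ δ ≤ η / 2 :=
    ⟨min (η / 2) (1 / 2), by positivity, (min_le_right _ _).trans_lt (by norm_num), min_le_left _ _⟩
  obtain ⟨s₀, -⟩ := hPS.exists_pos
  obtain ⟨x₀, -⟩ := hPX.exists_pos
  obtain ⟨v₀, -⟩ := (hκ x₀ s₀).exists_pos
  choose φ₀ hφ₀ using fun y => (hPZ v₀ y).exists_pos
  set q : X → V → ℝ := fun x v => ∑ s, PS s * κ x s v with hq_def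
  have hq : ∀ x, IsPMF (q x) := fun x => hPS.sum_mul fun s => hκ x s
  set Φ : V → (Y → Z) → ℝ := fun v φ => ∏ y, PZ v y (φ y) with hΦ_def
  have hΦ : ∀ v, IsPMF (Φ v) := fun v => IsPMF.pi fun y => hPZ v y
  set ζ : Option (V × (Y → Z)) → Y → Z := fun o => o.elim φ₀ Prod.snd with hζ
  set κ' : X → S → Option (V × (Y → Z)) → ℝ := fun x s =>
    mixNone δ fun w => κ x s w.1 * Φ w.1 w.2 with hκ'_def
  set q' : X → Option (V × (Y → Z)) → ℝ := fun x =>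
    mixNone δ fun w => q x w.1 * Φ w.1 w.2 with hq'_def
  have hκ' : ∀ x s, IsPMF (κ' x s) := fun x s => ((hκ x s).prod hΦ).mixNone hδ0.le hδ1.le
  have hq' : ∀ x, IsPMF (q' x) := fun x => ((hq x).prod hΦ).mixNone hδ0.le hδ1.le
  set P' : S × X × Y × Z → ℝ := fun b => ∑ w : X × S × Option (V × (Y → Z)) × Y,
    PX w.1 * (PS w.2.1 * (κ' w.1 w.2.1 w.2.2.1 * PYX w.1 w.2.2.2)) *
      if (w.2.1, w.1, w.2.2.2, ζ w.2.2.1 w.2.2.2) = b then 1 else 0 with hP'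
  set R : S × X × Y × Z → ℝ := fun b => PS b.1 * (PX b.2.1 * (PYX b.2.1 b.2.2.1 *
    if φ₀ b.2.2.1 = b.2.2.2 then 1 else 0)) with hR
  have hR1 : IsPMF R := isPMF_source_action_channel hPS hPX hPYX
    (r := fun _ _ y z => if φ₀ y = z then 1 else 0)
    (fun s x y => ⟨fun z => by dsimp only; split_ifs <;> norm_num, by simp⟩) fun _ _ _ _ => rfl
  have hmix : ∀ b, P' b = (1 - δ) * P b + δ * R b := by
    rintro ⟨s, x, y, z⟩
    have e : ∑ w : V × (Y → Z), (1 - δ) * (κ x s w.1 * Φ w.1 w.2) *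
        (if w.2 y = z then 1 else 0) = (1 - δ) * ∑ v, κ x s v * PZ v y z := by
      rw [Fintype.sum_prod_type, Finset.mul_sum]
      refine Finset.sum_congr rfl fun v _ => ?_
      rw [← sum_prod_mul_ite_apply (hPZ v) y z, Finset.mul_sum, Finset.mul_sum]
      exact Finset.sum_congr rfl fun φ _ => by ring
    have e' := sum_mul_ite_law_eq PX PS κ' PYX ζ s x y z
    rw [Fintype.sum_option] at e'
    simp only [hκ'_def, mixNone, hζ, Option.elim_none, Option.elim_some] at e'
    refine (e'.trans ?_)
    rw [hP, e]
    simp only [hR]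
    ring
  have hP'1 : IsPMF P' := by
    refine ⟨fun b => ?_, ?_⟩
    · rw [hmix]
      exact add_nonneg (mul_nonneg (by linarith) (hP1.1 b)) (mul_nonneg hδ0.le (hR1.1 b))
    · simp only [hmix, Finset.sum_add_distrib, ← Finset.mul_sum, hP1.2, hR1.2]
      ring
  suffices h : HasBlockCode PS PYX P' (η / 2) from
    (h.of_tvDist_le hPS hPYX (tvDist_convex_combination_le hP1 hR1 hδ0.le hmix)).mono (by linarith)
  set J := ∑ w : X × S × V, PX w.1 * (PS w.2.1 * κ w.1 w.2.1 w.2.2) *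
        Real.log (κ w.1 w.2.1 w.2.2 / q w.1 w.2.2) with hJ
  set C := ∑ w : X × Y, PX w.1 * PYX w.1 w.2 *
    Real.log (PYX w.1 w.2 / ∑ x, PX x * PYX x w.2) with hC
  rcases lt_or_ge 0 C with hC0 | hC0
  · have hJ' : ∑ w : X × S × Option (V × (Y → Z)), PX w.1 * (PS w.2.1 * κ' w.1 w.2.1 w.2.2) *
        Real.log (κ' w.1 w.2.1 w.2.2 / q' w.1 w.2.2) = (1 - δ) * J := by
      simp only [hJ, Fintype.sum_prod_type, ← mul_assoc, Finset.mul_sum]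
      refine Finset.sum_congr rfl fun x _ => Finset.sum_congr rfl fun s _ => ?_
      have e := (sum_mixNone_mul_log (fun w : V × (Y → Z) => κ x s w.1 * Φ w.1 w.2)
        (fun w => q x w.1 * Φ w.1 w.2) hδ0 hδ1).trans
          (congrArg _ (sum_mul_mul_log_mul_div (κ x s) (q x) hΦ))
      have e2 := congrArg (fun t => PX x * PS s * t) e
      simp only [Finset.mul_sum] at e2
      refine Eq.trans (Finset.sum_congr rfl fun o _ => ?_)
        (e2.trans (Finset.sum_congr rfl fun v _ => ?_))
      · simp only [hκ'_def, hq'_def]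
        ring
      · ring
    refine hasBlockCode_of_lt (q := q') (κ := κ') hPS hPYX hPX hκ' hq' (fun y => rfl) ?_ ?_ hC0 ζ
      hP'1 (fun b => rfl) (half_pos hη)
    · intro x s o _ h2 h3
      cases o with
      | none => exact hδ0
      | some w =>
        have h4 : 0 < κ x s w.1 * Φ w.1 w.2 := pos_of_mul_pos_right h3 (by linarith)
        have h5 : 0 < κ x s w.1 := pos_of_mul_pos_left h4 ((hΦ _).1 _)
        have h6 : 0 < Φ w.1 w.2 := pos_of_mul_pos_right h4 ((hκ _ _).1 _)
        refine mul_pos (by linarith) (mul_pos ?_ h6)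
        exact (mul_pos h2 h5).trans_le (Finset.single_le_sum (f := fun s => PS s * κ x s w.1)
          (fun s _ => mul_nonneg (hPS.1 s) ((hκ x s).1 _)) (Finset.mem_univ s))
    · rw [hJ']
      nlinarith
  · have hp1 : IsPMF (fun w : X × S × V => PX w.1 * (PS w.2.1 * κ w.1 w.2.1 w.2.2)) :=
      hPX.prod (g := fun x (w : S × V) => PS w.1 * κ x w.1 w.2) fun x => hPS.prod fun s => hκ x s
    have hp2 : IsPMF (fun w : X × S × V => PX w.1 * (PS w.2.1 * q w.1 w.2.2)) :=
      hPX.prod (g := fun x (w : S × V) => PS w.1 * q x w.2) fun x => hPS.prod fun _ => hq x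
    have hqpos : ∀ x s v, PS s ≠ 0 → q x v = 0 → κ x s v = 0 := fun x s v h1 h2 => by
      have h3 := (Finset.sum_eq_zero_iff_of_nonneg
        fun s _ => mul_nonneg (hPS.1 s) ((hκ x s).1 v)).1 h2 s (Finset.mem_univ s)
      exact (mul_eq_zero.1 h3).resolve_left h1
    have hind := eq_of_sum_mul_log_div_nonpos hp1 hp2
      (by
        rintro ⟨x, s, v⟩ h0
        rcases mul_eq_zero.1 h0 with h | h
        · simp [h]
        rcases eq_or_ne (PS s) 0 with h1 | h1
        · simp [h1]
        · simp [hqpos x s v h1 ((mul_eq_zero.1 h).resolve_left h1)])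
      (by
        refine le_trans (le_of_eq (Finset.sum_congr rfl fun w _ => ?_)) (hrate.trans hC0)
        rcases eq_or_ne (PX w.1) 0 with h | h
        · simp [h]
        rcases eq_or_ne (PS w.2.1) 0 with h' | h'
        · simp [h']
        rw [mul_div_mul_left _ _ h, mul_div_mul_left _ _ h'])
    refine hasBlockCode_of_indep (q := q') hPS hPYX hPX hq' ζ (fun b => ?_) (half_pos hη)
    refine Finset.sum_congr rfl fun w => ?_
    obtain ⟨x, s, o, y⟩ := w
    intro _
    congr 1
    cases o with
    | none => rfl
    | some v =>
      have := hind (x, s, v.1)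
      simp only [hκ'_def, hq'_def, mixNone] at this ⊢
      linear_combination ((1 - δ) * Φ v.1 v.2 * PYX x y) * this

/-- **Theorem 3 (Strictly causal encoder, achievability).**
If there are a finite set `V` and a joint pmf `Q` on `S × X × Y × Ŝ × V` factoring as
`P_S · P_X · P_{V|XS} · P_{Y|X} · P_{Ŝ|VY}` with `I(X,V;S) ≤ I(X,V;Y)`, then the
`(S,X,Y,Ŝ)`-marginal `P` of `Q` is achievable with a strictly causal encoder. -/
theorem strictly_causal_achievability
    {S X Y Z V : Type} [Fintype S] [Fintype X] [Fintype Y] [Fintype Z] [Fintype V]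
    (PS : S → ℝ) (PYX : X → Y → ℝ)
    (hPS : IsPMF PS) (hPYX : ∀ x, IsPMF (PYX x))
    (PX : X → ℝ) (PVgXS : X → S → V → ℝ) (PZgVY : V → Y → Z → ℝ)
    (hPX : IsPMF PX) (hPVgXS : ∀ x s, IsPMF (PVgXS x s))
    (hPZgVY : ∀ v y, IsPMF (PZgVY v y))
    (Q : S × X × Y × Z × V → ℝ)
    (hQ : ∀ s x y z v,
      Q (s, x, y, z, v) = PS s * PX x * PVgXS x s v * PYX x y * PZgVY v y z)
    (hMI : mutInfo Q (fun ω => (ω.2.1, ω.2.2.2.2)) (fun ω => ω.1)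
         ≤ mutInfo Q (fun ω => (ω.2.1, ω.2.2.2.2)) (fun ω => ω.2.2.1))
    (P : S × X × Y × Z → ℝ)
    (hP : ∀ s x y z, P (s, x, y, z) = ∑ v, Q (s, x, y, z, v)) :
    Achievable PS PYX EncoderClass.strictlyCausal P := by
  have hP' : ∀ s x y z, P (s, x, y, z) =
      PS s * (PX x * (PYX x y * ∑ v, PVgXS x s v * PZgVY v y z)) := by
    intro s x y z
    rw [hP]
    simp only [hQ, Finset.mul_sum]
    exact Finset.sum_congr rfl fun v _ => by ring
  rw [mutInfo_source_eq hPYX hPX hPVgXS hPZgVY hQ,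
    mutInfo_channel_eq hPS hPYX hPVgXS hPZgVY hQ,
    div_le_div_iff_of_pos_right (Real.log_pos one_lt_two)] at hMI
  exact achievable_of_hasBlockCode hPS hPYX
    (isPMF_source_action_channel hPS hPX hPYX
      (fun s x y => (hPVgXS x s).sum_mul fun v => hPZgVY v y) hP')
    fun η hη => hasBlockCode_of_rate_le hPS hPYX hPX hPVgXS hPZgVY hMI hP' hη

end
end

section
/- Any achievable pmf necessarily factors according to the source and channel: if P_{SXYŜ} on 𝒮×𝒳×𝒴×Ŝ is achievable (with noncausal, causal, or strictly causal encoder), then its 𝒮-marginal equals P_S, and for all s, x, y with P(s,x) > 0, the conditional probability of Y = y given (S,X) = (s,x) equals P_{Y|X}(y|x); equivalently, P_{SXYŜ} factors as P_S·P_{X|S}·P_{Y|X}·P_{Ŝ|SXY}. -/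
open scoped BigOperators

noncomputable section

/-- Under a product pmf, the expectation of a function of one coordinate is its expectation
under the corresponding factor. -/
theorem sum_prod_mul_coord {ι B : Type*} [Fintype ι] [DecidableEq ι] [Fintype B]
    (p : ι → B → ℝ) (hp : ∀ i, ∑ b, p i b = 1) (h : B → ℝ) (i : ι) :
    ∑ y : ι → B, (∏ j, p j (y j)) * h (y i) = ∑ b, p i b * h b := by
  have key : ∀ y : ι → B, (∏ j, p j (y j)) * h (y i)
      = ∏ j, p j (y j) * (if j = i then h (y j) else 1) := by
    intro y
    rw [Finset.prod_mul_distrib, Finset.prod_ite_eq' Finset.univ i (fun j => h (y j))]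
    simp
  simp_rw [key]
  rw [← Fintype.prod_sum (fun j b => p j b * (if j = i then h b else 1)),
    Finset.prod_eq_single i]
  · simp
  · intro j _ hj
    simp [hj, hp]
  · simp

theorem inducedP_nonneg {S X Y : Type*} [Fintype S] [Fintype Y] {n : ℕ}
    {PS : S → ℝ} {PYX : X → Y → ℝ} (hPS : IsPMF PS) (hPYX : ∀ x, IsPMF (PYX x))
    (f : Fin n → (Fin n → S) → X) (sy : (Fin n → S) × (Fin n → Y)) :
    0 ≤ inducedP PS PYX f sy :=
  mul_nonneg (Finset.prod_nonneg fun _ _ => hPS.1 _)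
    (Finset.prod_nonneg fun _ _ => (hPYX _).1 _)

/-- Conditioning on the source sequence: the output at time `i` has law `PYX (f i s)`. -/
theorem sum_inducedP_mul {S X Y : Type*} [Fintype S] [Fintype Y] {n : ℕ}
    (PS : S → ℝ) {PYX : X → Y → ℝ} (hPYX : ∀ x, IsPMF (PYX x))
    (f : Fin n → (Fin n → S) → X) (φ : S → X → Y → ℝ) (i : Fin n) :
    ∑ sy, inducedP PS PYX f sy * φ (sy.1 i) (f i sy.1) (sy.2 i)
      = ∑ s : Fin n → S, (∏ j, PS (s j)) *
          ∑ y, PYX (f i s) y * φ (s i) (f i s) y := by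
  rw [Fintype.sum_prod_type]
  refine Finset.sum_congr rfl fun s _ => ?_
  simp only [inducedP, mul_assoc]
  rw [← Finset.mul_sum,
    sum_prod_mul_coord (fun j => PYX (f j s)) (fun j => (hPYX _).2) (φ (s i) (f i s)) i]

theorem sum_inducedP {S X Y : Type*} [Fintype S] [Fintype Y] {n : ℕ}
    {PS : S → ℝ} {PYX : X → Y → ℝ} (hPS : IsPMF PS) (hPYX : ∀ x, IsPMF (PYX x))
    (f : Fin n → (Fin n → S) → X) : ∑ sy, inducedP PS PYX f sy = 1 := by
  classical
  rw [Fintype.sum_prod_type]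
  simp only [inducedP]
  simp_rw [← Finset.mul_sum]
  have h1 : ∀ s : Fin n → S, ∑ y : Fin n → Y, ∏ j, PYX (f j s) (y j) = 1 := fun s => by
    rw [← Fintype.prod_sum (fun j b => PYX (f j s) b)]
    simp [(hPYX _).2]
  simp only [h1, mul_one]
  rw [← Fintype.prod_sum (fun (_ : Fin n) b => PS b)]
  simp [hPS.2]

theorem sum_mul_empDist {n : ℕ} {α : Type*} [Fintype α] (φ : α → ℝ) (w : Fin n → α) :
    ∑ a, φ a * empDist w a = (∑ i, φ (w i)) / n := by
  classical
  simp only [empDist, mul_div_assoc', ← Finset.sum_div, Finset.mul_sum]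
  rw [Finset.sum_comm]
  congr 1
  refine Finset.sum_congr rfl fun i _ => ?_
  simp [Set.indicator_apply]

theorem abs_sum_mul_sub_le_tvDist {α : Type*} [Fintype α] {φ : α → ℝ} (hφ : ∀ a, |φ a| ≤ 1)
    (P Q : α → ℝ) : |∑ a, φ a * P a - ∑ a, φ a * Q a| ≤ 2 * tvDist P Q := by
  have : 2 * tvDist P Q = ∑ a, |P a - Q a| := by unfold tvDist; ring
  rw [this, ← Finset.sum_sub_distrib]
  refine (Finset.abs_sum_le_sum_abs _ _).trans (Finset.sum_le_sum fun a _ => ?_)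
  rw [← mul_sub, abs_mul]
  exact mul_le_of_le_one_left (abs_nonneg _) (hφ a)

/-- A bounded statistic whose expectation at every time of every code is `e` has mean `e`
under every achievable pmf. -/
theorem Achievable.sum_mul_eq {S X Y Z : Type*} [Fintype S] [Fintype X] [Fintype Y] [Fintype Z]
    {PS : S → ℝ} {PYX : X → Y → ℝ} (hPS : IsPMF PS) (hPYX : ∀ x, IsPMF (PYX x))
    {c : EncoderClass} {P : S × X × Y × Z → ℝ} (hP : IsPMF P) (hach : Achievable PS PYX c P)
    {φ : S × X × Y × Z → ℝ} (hφ : ∀ a, |φ a| ≤ 1) {e : ℝ}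
    (he : ∀ (n : ℕ) (f : Fin n → (Fin n → S) → X) (g : Fin n → (Fin n → Y) → Z) (i : Fin n),
      ∑ sy, inducedP PS PYX f sy * φ (sy.1 i, f i sy.1, sy.2 i, g i sy.2) = e) :
    ∑ a, φ a * P a = e := by
  classical
  refine eq_of_abs_sub_le_all fun δ hδ => ?_
  obtain ⟨n, hn, f, g, -, hprob⟩ := hach (δ / 4) (by positivity)
  have hn' : (0 : ℝ) < n := by exact_mod_cast hn
  set Q := inducedP PS PYX f with hQ
  have hQ0 : ∀ sy, 0 ≤ Q sy := inducedP_nonneg hPS hPYX f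
  have hQ1 : ∑ sy, Q sy = 1 := sum_inducedP hPS hPYX f
  set w : (Fin n → S) × (Fin n → Y) → Fin n → S × X × Y × Z :=
    fun sy i => (sy.1 i, f i sy.1, sy.2 i, g i sy.2) with hw
  set E : Set ((Fin n → S) × (Fin n → Y)) := {sy | δ / 4 < tvDist (empDist (w sy)) P} with hE
  have hprob' : ∑ sy, E.indicator Q sy < δ / 4 := hprob
  have hmean : ∑ sy, Q sy * ∑ a, φ a * empDist (w sy) a = e := by
    simp only [sum_mul_empDist, mul_div_assoc', ← Finset.sum_div, Finset.mul_sum]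
    rw [Finset.sum_comm, Finset.sum_congr rfl fun i _ => he n f g i]
    simp only [Finset.sum_const, Finset.card_univ, Fintype.card_fin, nsmul_eq_mul]
    field_simp
  have hLP : |∑ a, φ a * P a| ≤ 1 := by
    rw [← hP.2]
    refine (Finset.abs_sum_le_sum_abs _ _).trans (Finset.sum_le_sum fun a _ => ?_)
    rw [abs_mul, abs_of_nonneg (hP.1 a)]
    exact mul_le_of_le_one_left (hP.1 a) (hφ a)
  have hLE : ∀ sy, |∑ a, φ a * empDist (w sy) a| ≤ 1 := fun sy => by
    rw [sum_mul_empDist, abs_div, abs_of_pos hn', div_le_one hn']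
    refine (Finset.abs_sum_le_sum_abs _ _).trans
      ((Finset.sum_le_sum fun i _ => hφ (w sy i)).trans ?_)
    simp
  have hpt : ∀ sy, Q sy * |∑ a, φ a * P a - ∑ a, φ a * empDist (w sy) a|
      ≤ Q sy * (δ / 2) + 2 * E.indicator Q sy := fun sy => by
    by_cases hsy : sy ∈ E
    · rw [Set.indicator_of_mem hsy]
      have h2 : |∑ a, φ a * P a - ∑ a, φ a * empDist (w sy) a| ≤ 2 :=
        (abs_sub _ _).trans (by linarith [hLE sy])
      nlinarith [mul_le_mul_of_nonneg_left h2 (hQ0 sy), mul_nonneg (hQ0 sy) hδ.le]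
    · rw [Set.indicator_of_notMem hsy, abs_sub_comm]
      have h1 := abs_sum_mul_sub_le_tvDist hφ (empDist (w sy)) P
      have h2 : tvDist (empDist (w sy)) P ≤ δ / 4 := not_lt.mp hsy
      have := mul_le_mul_of_nonneg_left (h1.trans (by linarith : _ ≤ δ / 2)) (hQ0 sy)
      linarith
  calc |∑ a, φ a * P a - e|
      = |∑ sy, Q sy * (∑ a, φ a * P a - ∑ a, φ a * empDist (w sy) a)| := by
        simp only [mul_sub, Finset.sum_sub_distrib]
        rw [hmean, ← Finset.sum_mul, hQ1, one_mul]
    _ ≤ ∑ sy, Q sy * |∑ a, φ a * P a - ∑ a, φ a * empDist (w sy) a| := by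
        refine (Finset.abs_sum_le_sum_abs _ _).trans_eq (Finset.sum_congr rfl fun sy _ => ?_)
        rw [abs_mul, abs_of_nonneg (hQ0 sy)]
    _ ≤ ∑ sy, (Q sy * (δ / 2) + 2 * E.indicator Q sy) := Finset.sum_le_sum fun sy _ => hpt sy
    _ = δ / 2 + 2 * ∑ sy, E.indicator Q sy := by
        rw [Finset.sum_add_distrib, ← Finset.sum_mul, hQ1, one_mul, ← Finset.mul_sum]
    _ ≤ δ := by linarith

/-- **Necessary factorization of achievable distributions.**
If `P` on `S × X × Y × Ŝ` is achievable (for any encoder causality class), then its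
`S`-marginal equals `P_S`, and for all `s, x, y` with `P(s,x) > 0` the conditional
probability of `Y = y` given `(S,X) = (s,x)` equals `P_{Y|X}(y|x)`; i.e. `P` factors
as `P_S · P_{X|S} · P_{Y|X} · P_{Ŝ|SXY}`. -/
theorem achievable_factors
    {S X Y Z : Type} [Fintype S] [Fintype X] [Fintype Y] [Fintype Z]
    (PS : S → ℝ) (PYX : X → Y → ℝ)
    (hPS : IsPMF PS) (hPYX : ∀ x, IsPMF (PYX x))
    (c : EncoderClass)
    (P : S × X × Y × Z → ℝ) (hP : IsPMF P)
    (hach : Achievable PS PYX c P) :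
    (∀ s, (∑ x, ∑ y, ∑ z, P (s, x, y, z)) = PS s) ∧
    (∀ s x y, 0 < (∑ y', ∑ z, P (s, x, y', z)) →
      (∑ z, P (s, x, y, z)) = (∑ y', ∑ z, P (s, x, y', z)) * PYX x y) := by
  classical
  constructor
  · intro s
    have h := hach.sum_mul_eq hPS hPYX hP (φ := fun a => if a.1 = s then 1 else 0) (e := PS s)
      (fun a => by split_ifs <;> simp) (fun n f g i => by
        refine (sum_inducedP_mul PS hPYX f (fun s' _ _ => if s' = s then 1 else 0) i).trans ?_
        simp only [← Finset.sum_mul, (hPYX _).2, one_mul]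
        rw [sum_prod_mul_coord (fun _ => PS) (fun _ => hPS.2) (fun s' => if s' = s then 1 else 0) i]
        simp)
    rw [← h, Fintype.sum_prod_type, Finset.sum_eq_single s (fun s' _ hs' => by simp [hs']) (by simp)]
    simp [Fintype.sum_prod_type]
  · intro s x y _
    have hle : PYX x y ≤ 1 :=
      (Finset.single_le_sum (fun b _ => (hPYX x).1 b) (Finset.mem_univ y)).trans_eq (hPYX x).2
    have h0 : 0 ≤ PYX x y := (hPYX x).1 y
    have h := hach.sum_mul_eq hPS hPYX hP (e := 0)
      (φ := fun a => if a.1 = s ∧ a.2.1 = x then (if a.2.2.1 = y then 1 else 0) - PYX x y else 0)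
      (fun a => by
        rw [abs_le]
        split_ifs <;> constructor <;> linarith)
      (fun n f g i => by
        refine (sum_inducedP_mul PS hPYX f (fun s' x' y' =>
          if s' = s ∧ x' = x then (if y' = y then 1 else 0) - PYX x y else 0) i).trans ?_
        refine Finset.sum_eq_zero fun s' _ => mul_eq_zero_of_right _ ?_
        by_cases hc : s' i = s ∧ f i s' = x
        · simp [hc, mul_sub, ← Finset.sum_mul, (hPYX x).2]
        · simp [hc])
    simp only [Fintype.sum_prod_type] at h
    rw [Finset.sum_eq_single s (fun s' _ hs' => by simp [hs']) (by simp),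
      Finset.sum_eq_single x (fun x' _ hx' => by simp [hx']) (by simp)] at h
    simp only [and_self, if_true, sub_mul, Finset.sum_sub_distrib, ← Finset.mul_sum] at h
    rw [Finset.sum_eq_single y (fun y' _ hy' => by simp [hy']) (by simp)] at h
    simp only [if_true, one_mul] at h
    linarith

end
end

section
/- The coordination region 𝒞, i.e., the set of achievable pmfs P_{SXYŜ} on 𝒮×𝒳×𝒴×Ŝ (for a fixed encoder causality class), is convex: if P and P' are both achievable and λ ∈ [0,1], then λP + (1−λ)P' is achievable. -/
open scoped BigOperators

noncomputable section

/-- Number of occurrences of `a` in the sequence `w`. -/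
def occCount {n : ℕ} {α : Type*} (w : Fin n → α) (a : α) : ℝ :=
  ∑ i : Fin n, ({i | w i = a} : Set (Fin n)).indicator (fun _ => (1 : ℝ)) i

lemma sum_occCount {n : ℕ} {α : Type*} [Fintype α] (w : Fin n → α) :
    ∑ a, occCount w a = n := by
  classical
  unfold occCount
  rw [Finset.sum_comm]
  simp [Set.indicator_apply]

lemma occCount_nonneg {n : ℕ} {α : Type*} (w : Fin n → α) (a : α) : 0 ≤ occCount w a :=
  Finset.sum_nonneg fun _ _ => Set.indicator_nonneg (fun _ _ => zero_le_one) _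

lemma occCount_add {m n : ℕ} {α : Type*} (w : Fin (m + n) → α) (a : α) :
    occCount w a = occCount (fun i => w (Fin.castAdd n i)) a
      + occCount (fun i => w (Fin.natAdd m i)) a := by
  classical
  simp only [occCount, Fin.sum_univ_add, Set.indicator_apply, Set.mem_ofPred_eq]

/-- Unnormalised `ℓ¹` distance between the type of `w` and the target `Q`. -/
def countDist {n : ℕ} {α : Type*} [Fintype α] (w : Fin n → α) (Q : α → ℝ) : ℝ :=
  ∑ a, |occCount w a - Q a|

lemma countDist_nonneg {n : ℕ} {α : Type*} [Fintype α] (w : Fin n → α) (Q : α → ℝ) :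
    0 ≤ countDist w Q :=
  Finset.sum_nonneg fun _ _ => abs_nonneg _

lemma countDist_add_le {m n : ℕ} {α : Type*} [Fintype α] (w : Fin (m + n) → α)
    (Q Q' : α → ℝ) :
    countDist w (fun t => Q t + Q' t) ≤ countDist (fun i => w (Fin.castAdd n i)) Q
      + countDist (fun i => w (Fin.natAdd m i)) Q' := by
  unfold countDist
  rw [← Finset.sum_add_distrib]
  refine Finset.sum_le_sum fun a _ => ?_
  rw [occCount_add, add_sub_add_comm]
  exact abs_add_le _ _

lemma countDist_le_add {n : ℕ} {α : Type*} [Fintype α] (w : Fin n → α) (Q Q' : α → ℝ) :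
    countDist w Q' ≤ countDist w Q + ∑ a, |Q a - Q' a| := by
  unfold countDist
  rw [← Finset.sum_add_distrib]
  exact Finset.sum_le_sum fun a _ => abs_sub_le _ _ _

lemma countDist_eq_tvDist {n : ℕ} (hn : 0 < n) {α : Type*} [Fintype α] (w : Fin n → α)
    (P : α → ℝ) : countDist w (fun t => n * P t) = 2 * n * tvDist (empDist w) P := by
  have hn' : (0 : ℝ) < n := by exact_mod_cast hn
  unfold countDist tvDist
  rw [mul_div_assoc', mul_assoc, mul_div_cancel_left₀ _ two_ne_zero, Finset.mul_sum]
  refine Finset.sum_congr rfl fun a _ => ?_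
  have h : occCount w a = n * empDist w a := by
    unfold empDist occCount
    field_simp
  rw [h, ← mul_sub, abs_mul, abs_of_pos hn']

lemma tvDist_empDist_le_one {n : ℕ} (hn : 0 < n) {α : Type*} [Fintype α] (w : Fin n → α)
    {P : α → ℝ} (hP : IsPMF P) : tvDist (empDist w) P ≤ 1 := by
  have hn' : (0 : ℝ) < n := by exact_mod_cast hn
  have h : countDist w (fun t => n * P t) ≤ 2 * n := by
    calc countDist w (fun t => n * P t)
        ≤ ∑ a, (occCount w a + n * P a) := by
          refine Finset.sum_le_sum fun a _ => ?_
          have h1 := occCount_nonneg w a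
          have h2 := mul_nonneg hn'.le (hP.1 a)
          rw [abs_le]
          constructor <;> linarith
      _ = 2 * n := by
          rw [Finset.sum_add_distrib, sum_occCount, ← Finset.mul_sum, hP.2]
          ring
  rw [countDist_eq_tvDist hn] at h
  have h2n : (0 : ℝ) < 2 * n := by positivity
  exact le_of_mul_le_mul_left (by linarith) h2n

lemma prob_le_of_markov {Ω : Type*} [Fintype Ω] {p : Ω → ℝ} (hp : ∀ ω, 0 ≤ p ω)
    {φ : Ω → ℝ} (hφ : ∀ ω, 0 ≤ φ ω) (ε : ℝ) :
    ε * prob p {ω | ε < φ ω} ≤ ∑ ω, p ω * φ ω := by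
  unfold prob
  rw [Finset.mul_sum]
  refine Finset.sum_le_sum fun ω _ => ?_
  by_cases h : ε < φ ω
  · rw [Set.indicator_of_mem (by exact h), mul_comm]
    exact mul_le_mul_of_nonneg_left h.le (hp ω)
  · rw [Set.indicator_of_notMem (by exact h), mul_zero]
    exact mul_nonneg (hp ω) (hφ ω)

lemma expect_le_add_prob {Ω : Type*} [Fintype Ω] {p : Ω → ℝ} (hp : IsPMF p)
    {φ : Ω → ℝ} (hφ : ∀ ω, φ ω ≤ 1) {ε : ℝ} (hε : 0 ≤ ε) :
    ∑ ω, p ω * φ ω ≤ ε + prob p {ω | ε < φ ω} := by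
  have h1 : ε = ∑ ω, p ω * ε := by rw [← Finset.sum_mul, hp.2, one_mul]
  unfold prob
  nth_rw 1 [h1]
  rw [← Finset.sum_add_distrib]
  refine Finset.sum_le_sum fun ω _ => ?_
  have h0 := hp.1 ω
  by_cases h : ε < φ ω
  · rw [Set.indicator_of_mem (by exact h)]
    nlinarith [mul_le_mul_of_nonneg_left (hφ ω) h0, mul_nonneg h0 hε]
  · rw [Set.indicator_of_notMem (by exact h), add_zero]
    exact mul_le_mul_of_nonneg_left (not_lt.mp h) h0

lemma inducedP_isPMF {S X Y : Type*} [Fintype S] [Fintype Y] {n : ℕ}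
    {PS : S → ℝ} {PYX : X → Y → ℝ} (hPS : IsPMF PS) (hPYX : ∀ x, IsPMF (PYX x))
    (f : Fin n → (Fin n → S) → X) : IsPMF (inducedP PS PYX f) := by
  refine ⟨fun sy => mul_nonneg (Finset.prod_nonneg fun _ _ => hPS.1 _)
    (Finset.prod_nonneg fun _ _ => (hPYX _).1 _), ?_⟩
  have hY (s : Fin n → S) : ∑ y : Fin n → Y, ∏ i, PYX (f i s) (y i) = 1 := by
    rw [← Fintype.prod_sum (fun i => PYX (f i s))]
    simp [(hPYX _).2]
  have hS : ∑ s : Fin n → S, ∏ i, PS (s i) = 1 := by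
    rw [← Fintype.prod_sum (fun _ : Fin n => PS)]
    simp [hPS.2]
  simp only [inducedP, Fintype.sum_prod_type, ← Finset.mul_sum, hY, mul_one, hS]

/-- Concatenation of block maps: the first `m` letters are processed by `f`, the last `n`
by `f'`. -/
def blockConcat {A B : Type*} {m n : ℕ} (f : Fin m → (Fin m → A) → B)
    (f' : Fin n → (Fin n → A) → B) : Fin (m + n) → (Fin (m + n) → A) → B :=
  fun i s => Fin.addCases (fun j => f j fun k => s (Fin.castAdd n k))
    (fun j => f' j fun k => s (Fin.natAdd m k)) i

@[simp] lemma blockConcat_castAdd {A B : Type*} {m n : ℕ} (f : Fin m → (Fin m → A) → B)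
    (f' : Fin n → (Fin n → A) → B) (i : Fin m) (s : Fin (m + n) → A) :
    blockConcat f f' (Fin.castAdd n i) s = f i fun k => s (Fin.castAdd n k) := by
  simp [blockConcat]

@[simp] lemma blockConcat_natAdd {A B : Type*} {m n : ℕ} (f : Fin m → (Fin m → A) → B)
    (f' : Fin n → (Fin n → A) → B) (i : Fin n) (s : Fin (m + n) → A) :
    blockConcat f f' (Fin.natAdd m i) s = f' i fun k => s (Fin.natAdd m k) := by
  simp [blockConcat]

lemma encOK_blockConcat {S X : Type*} {m n : ℕ} {c : EncoderClass}
    {f : Fin m → (Fin m → S) → X} {f' : Fin n → (Fin n → S) → X}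
    (hf : EncOK c f) (hf' : EncOK c f') : EncOK c (blockConcat f f') := by
  cases c with
  | noncausal => trivial
  | causal =>
    intro i s s' h
    induction i using Fin.addCases with
    | left i =>
      simp only [blockConcat_castAdd]
      exact hf i _ _ fun j hj => h (Fin.castAdd n j) (Fin.le_def.mpr hj)
    | right i =>
      simp only [blockConcat_natAdd]
      exact hf' i _ _ fun j hj => h (Fin.natAdd m j) (Nat.add_le_add_left hj m)
  | strictlyCausal =>
    intro i s s' h
    induction i using Fin.addCases with
    | left i =>
      simp only [blockConcat_castAdd]
      exact hf i _ _ fun j hj => h (Fin.castAdd n j) (Fin.lt_def.mpr hj)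
    | right i =>
      simp only [blockConcat_natAdd]
      exact hf' i _ _ fun j hj => h (Fin.natAdd m j) (Nat.add_lt_add_left hj m)

lemma inducedP_blockConcat {S X Y : Type*} {m n : ℕ} (PS : S → ℝ) (PYX : X → Y → ℝ)
    (f : Fin m → (Fin m → S) → X) (f' : Fin n → (Fin n → S) → X)
    (sy : (Fin (m + n) → S) × (Fin (m + n) → Y)) :
    inducedP PS PYX (blockConcat f f') sy =
      inducedP PS PYX f (fun i => sy.1 (Fin.castAdd n i), fun i => sy.2 (Fin.castAdd n i)) *
      inducedP PS PYX f' (fun i => sy.1 (Fin.natAdd m i), fun i => sy.2 (Fin.natAdd m i)) := by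
  simp only [inducedP, Fin.prod_univ_add, blockConcat_castAdd, blockConcat_natAdd]
  ring

lemma sum_split_blocks {S Y : Type*} [Fintype S] [Fintype Y] {m n : ℕ}
    (F : (Fin m → S) × (Fin m → Y) → (Fin n → S) × (Fin n → Y) → ℝ) :
    ∑ sy : (Fin (m + n) → S) × (Fin (m + n) → Y),
      F (fun i => sy.1 (Fin.castAdd n i), fun i => sy.2 (Fin.castAdd n i))
        (fun i => sy.1 (Fin.natAdd m i), fun i => sy.2 (Fin.natAdd m i)) =
      ∑ a, ∑ b, F a b := by
  rw [← Fintype.sum_prod_type']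
  refine (Fintype.sum_equiv ((Equiv.prodProdProdComm _ _ _ _).trans
    ((Fin.appendEquiv m n).prodCongr (Fin.appendEquiv m n))) _ _ fun x => ?_).symm
  simp [Fin.appendEquiv]

/-- The sequence of quadruples produced by the code `(f, g)`. -/
def codeSeq {S X Y Z : Type*} {n : ℕ} (f : Fin n → (Fin n → S) → X)
    (g : Fin n → (Fin n → Y) → Z) (sy : (Fin n → S) × (Fin n → Y)) : Fin n → S × X × Y × Z :=
  fun i => (sy.1 i, f i sy.1, sy.2 i, g i sy.2)

/-- Some block-`n` code has expected unnormalised distance at most `d` to the target `Q`. -/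
def MeanReachable {S X Y Z : Type*} [Fintype S] [Fintype X] [Fintype Y] [Fintype Z]
    (PS : S → ℝ) (PYX : X → Y → ℝ) (c : EncoderClass) (n : ℕ)
    (Q : S × X × Y × Z → ℝ) (d : ℝ) : Prop :=
  ∃ (f : Fin n → (Fin n → S) → X) (g : Fin n → (Fin n → Y) → Z), EncOK c f ∧
    ∑ sy, inducedP PS PYX f sy * countDist (codeSeq f g sy) Q ≤ d

section Coding

variable {S X Y Z : Type*} [Fintype S] [Fintype X] [Fintype Y] [Fintype Z]
  {PS : S → ℝ} {PYX : X → Y → ℝ} {c : EncoderClass}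

lemma MeanReachable.zero : MeanReachable (Z := Z) PS PYX c 0 (fun _ => 0) 0 := by
  refine ⟨fun i => i.elim0, fun i => i.elim0, ?_, ?_⟩
  · cases c with
    | noncausal => trivial
    | causal => exact fun i => i.elim0
    | strictlyCausal => exact fun i => i.elim0
  · simp [countDist, occCount]

lemma MeanReachable.add (hPS : IsPMF PS) (hPYX : ∀ x, IsPMF (PYX x)) {m n : ℕ}
    {Q Q' : S × X × Y × Z → ℝ} {d d' : ℝ} (h : MeanReachable PS PYX c m Q d)
    (h' : MeanReachable PS PYX c n Q' d') :
    MeanReachable PS PYX c (m + n) (fun t => Q t + Q' t) (d + d') := by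
  obtain ⟨f, g, hf, hd⟩ := h
  obtain ⟨f', g', hf', hd'⟩ := h'
  refine ⟨blockConcat f f', blockConcat g g', encOK_blockConcat hf hf', ?_⟩
  have hp := inducedP_isPMF hPS hPYX f
  have hp' := inducedP_isPMF hPS hPYX f'
  have hsplit := sum_split_blocks (m := m) (n := n) (S := S) (Y := Y) fun a b =>
    inducedP PS PYX f a * inducedP PS PYX f' b *
      (countDist (codeSeq f g a) Q + countDist (codeSeq f' g' b) Q')
  calc _ ≤ _ := Finset.sum_le_sum fun sy _ => ?_
    _ = _ := hsplit
    _ = ∑ a, inducedP PS PYX f a * countDist (codeSeq f g a) Q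
        + ∑ b, inducedP PS PYX f' b * countDist (codeSeq f' g' b) Q' := by
      simp only [mul_add, Finset.sum_add_distrib]
      congr 1
      · refine Finset.sum_congr rfl fun a _ => ?_
        rw [← Finset.sum_mul, ← Finset.mul_sum, hp'.2, mul_one]
      · rw [Finset.sum_comm]
        refine Finset.sum_congr rfl fun b _ => ?_
        rw [← Finset.sum_mul, ← Finset.sum_mul, hp.2, one_mul]
    _ ≤ d + d' := add_le_add hd hd'
  rw [inducedP_blockConcat]
  refine mul_le_mul_of_nonneg_left ?_ (mul_nonneg (hp.1 _) (hp'.1 _))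
  refine (countDist_add_le _ _ _).trans_eq ?_
  simp only [codeSeq, blockConcat_castAdd, blockConcat_natAdd]
  rfl

lemma MeanReachable.nsmul (hPS : IsPMF PS) (hPYX : ∀ x, IsPMF (PYX x)) {n : ℕ}
    {Q : S × X × Y × Z → ℝ} {d : ℝ} (h : MeanReachable PS PYX c n Q d) (k : ℕ) :
    MeanReachable PS PYX c (k * n) (fun t => k * Q t) (k * d) := by
  induction k with
  | zero => simpa using MeanReachable.zero
  | succ k ih => simpa [add_mul] using ih.add hPS hPYX h

lemma MeanReachable.perturb (hPS : IsPMF PS) (hPYX : ∀ x, IsPMF (PYX x)) {n : ℕ}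
    {Q : S × X × Y × Z → ℝ} {d : ℝ} (h : MeanReachable PS PYX c n Q d)
    (Q' : S × X × Y × Z → ℝ) :
    MeanReachable PS PYX c n Q' (d + ∑ t, |Q t - Q' t|) := by
  obtain ⟨f, g, hf, hd⟩ := h
  have hp := inducedP_isPMF hPS hPYX f
  refine ⟨f, g, hf, ?_⟩
  calc _ ≤ ∑ sy, inducedP PS PYX f sy * (countDist (codeSeq f g sy) Q + ∑ t, |Q t - Q' t|) :=
        Finset.sum_le_sum fun sy _ =>
          mul_le_mul_of_nonneg_left (countDist_le_add _ _ _) (hp.1 sy)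
    _ ≤ _ := by
        simp only [mul_add, Finset.sum_add_distrib, ← Finset.sum_mul, hp.2, one_mul]
        gcongr

lemma Achievable.exists_meanReachable (hPS : IsPMF PS) (hPYX : ∀ x, IsPMF (PYX x))
    {P : S × X × Y × Z → ℝ} (hP : IsPMF P) (h : Achievable PS PYX c P)
    {δ : ℝ} (hδ : 0 < δ) :
    ∃ n : ℕ, 0 < n ∧ MeanReachable PS PYX c n (fun t => n * P t) (n * δ) := by
  obtain ⟨n, hn, f, g, hf, hprob⟩ := h (δ / 4) (by positivity)
  refine ⟨n, hn, f, g, hf, ?_⟩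
  have hE := expect_le_add_prob (inducedP_isPMF hPS hPYX f)
    (φ := fun sy => tvDist (empDist (codeSeq f g sy)) P)
    (fun sy => tvDist_empDist_le_one hn _ hP) (ε := δ / 4) (by positivity)
  have hE' : ∑ sy, inducedP PS PYX f sy * tvDist (empDist (codeSeq f g sy)) P ≤ δ / 2 :=
    hE.trans ((add_le_add_right hprob.le _).trans_eq (by ring))
  simp only [countDist_eq_tvDist hn, mul_left_comm _ (2 * (n : ℝ)), ← Finset.mul_sum]
  calc _ ≤ 2 * (n : ℝ) * (δ / 2) := by gcongr
    _ = n * δ := by ring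

lemma achievable_of_meanReachable (hPS : IsPMF PS) (hPYX : ∀ x, IsPMF (PYX x))
    {P : S × X × Y × Z → ℝ}
    (h : ∀ δ : ℝ, 0 < δ →
      ∃ n : ℕ, 0 < n ∧ MeanReachable PS PYX c n (fun t => n * P t) (n * δ)) :
    Achievable PS PYX c P := by
  intro ε hε
  obtain ⟨n, hn, f, g, hf, hd⟩ := h (ε ^ 2) (by positivity)
  refine ⟨n, hn, f, g, hf, ?_⟩
  have hn' : (0 : ℝ) < 2 * n := by positivity
  simp only [countDist_eq_tvDist hn, mul_left_comm _ (2 * (n : ℝ)), ← Finset.mul_sum] at hd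
  have hE : ∑ sy, inducedP PS PYX f sy * tvDist (empDist (codeSeq f g sy)) P ≤ ε ^ 2 / 2 :=
    le_of_mul_le_mul_left (hd.trans_eq (by ring)) hn'
  have hM := prob_le_of_markov (inducedP_isPMF hPS hPYX f).1
    (φ := fun sy => tvDist (empDist (codeSeq f g sy)) P)
    (fun sy => div_nonneg (Finset.sum_nonneg fun _ _ => abs_nonneg _) zero_le_two) ε
  refine lt_of_mul_lt_mul_left ((hM.trans hE).trans_lt ?_) hε.le
  nlinarith [sq_pos_of_pos hε]

end Coding

/-- **The coordination region is convex**: if the pmfs `P` and `P'` on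
`S × X × Y × Ŝ` are both achievable (for a fixed encoder causality class) and
`0 ≤ λ ≤ 1`, then `λ·P + (1−λ)·P'` is achievable. -/
theorem coordination_region_convex
    {S X Y Z : Type} [Fintype S] [Fintype X] [Fintype Y] [Fintype Z]
    (PS : S → ℝ) (PYX : X → Y → ℝ)
    (hPS : IsPMF PS) (hPYX : ∀ x, IsPMF (PYX x))
    (c : EncoderClass)
    (P P' : S × X × Y × Z → ℝ) (hP : IsPMF P) (hP' : IsPMF P')
    (hach : Achievable PS PYX c P) (hach' : Achievable PS PYX c P')
    (l : ℝ) (hl0 : 0 ≤ l) (hl1 : l ≤ 1) :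
    Achievable PS PYX c (fun t => l * P t + (1 - l) * P' t) := by
  refine achievable_of_meanReachable hPS hPYX fun δ hδ => ?_
  obtain ⟨m, hm, hr⟩ := hach.exists_meanReachable hPS hPYX hP (half_pos hδ)
  obtain ⟨n, hn, hr'⟩ := hach'.exists_meanReachable hPS hPYX hP' (half_pos hδ)
  obtain ⟨N, hN⟩ := exists_nat_gt (4 / δ)
  have hN0 : (0 : ℝ) < N := lt_trans (by positivity) hN
  have hlN : 0 ≤ l * N := by positivity
  obtain ⟨p, hpl, hpu⟩ : ∃ p : ℕ, (p : ℝ) ≤ l * N ∧ l * N < p + 1 :=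
    ⟨_, Nat.floor_le hlN, Nat.lt_floor_add_one _⟩
  have hpN : p ≤ N := by
    have : (p : ℝ) ≤ N := hpl.trans (mul_le_of_le_one_left hN0.le hl1)
    exact_mod_cast this
  have hcode := ((hr.nsmul hPS hPYX (p * n)).add hPS hPYX
    (hr'.nsmul hPS hPYX ((N - p) * m)))
  have hlen : p * n * m + (N - p) * m * n = N * (m * n) := by
    obtain ⟨q, rfl⟩ := Nat.exists_eq_add_of_le hpN
    rw [Nat.add_sub_cancel_left]
    ring
  rw [hlen] at hcode
  refine ⟨N * (m * n), Nat.mul_pos (by exact_mod_cast hN0) (Nat.mul_pos hm hn), ?_⟩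
  obtain ⟨f, g, hf, hd⟩ := hcode.perturb hPS hPYX
    (fun t => ((N * (m * n) : ℕ) : ℝ) * (l * P t + (1 - l) * P' t))
  refine ⟨f, g, hf, hd.trans ?_⟩
  have hmn : (0 : ℝ) < m * n := by positivity
  have hsum : ∑ t, |((p * n : ℕ) : ℝ) * (m * P t) + (((N - p) * m : ℕ) : ℝ) * (n * P' t)
      - ((N * (m * n) : ℕ) : ℝ) * (l * P t + (1 - l) * P' t)| ≤ 2 * (m * n : ℝ) := by
    calc _ ≤ ∑ t, (m * n : ℝ) * (P t + P' t) := by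
          refine Finset.sum_le_sum fun t _ => ?_
          have h1 := hP.1 t
          have h2 := hP'.1 t
          have heq : ((p * n : ℕ) : ℝ) * (m * P t) + (((N - p) * m : ℕ) : ℝ) * (n * P' t)
              - ((N * (m * n) : ℕ) : ℝ) * (l * P t + (1 - l) * P' t)
              = (m * n : ℝ) * ((p - l * N) * (P t - P' t)) := by
            push_cast [Nat.cast_sub hpN]
            ring
          rw [heq, abs_mul, abs_of_pos hmn]
          refine mul_le_mul_of_nonneg_left ?_ hmn.le
          have ha : |(p : ℝ) - l * N| ≤ 1 := abs_le.mpr ⟨by linarith, by linarith⟩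
          have hb : |P t - P' t| ≤ P t + P' t := abs_le.mpr ⟨by linarith, by linarith⟩
          rw [abs_mul]
          exact (mul_le_of_le_one_left (abs_nonneg _) ha).trans hb
      _ = 2 * (m * n : ℝ) := by
          rw [← Finset.mul_sum, Finset.sum_add_distrib, hP.2, hP'.2]
          ring
  refine (add_le_add_right hsum _).trans ?_
  have hNδ : 4 < N * δ := (div_lt_iff₀ hδ).mp hN
  push_cast [Nat.cast_sub hpN]
  nlinarith [mul_pos hmn (sub_pos.mpr hNδ)]

end
end
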